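/- arXiv:2605.29787 — 13 statements merged into one kernel-verified Lean document; each statement's English description precedes it below -/
import Mathlib

section
/- Let α ∈ (1,∞) and let p be a probability distribution on a product of finite sets A₁×B₁×A₂×B₂ whose marginal on A₁×B₁×B₂ factorizes as p(a₁,b₁,b₂) = p_{A₁B₁}(a₁,b₁)·p_{B₂}(b₂) for all a₁,b₁,b₂ (i.e., the side information B₂ is generated independently of the past A₁B₁). Then H_α^↓(A₁A₂|B₁B₂)_p ≥ H_α^↓(A₁|B₁)_p + min over all pairs (a₁,b₁) with p_{A₁B₁}(a₁,b₁) > 0 of H_α^↓(A₂|B₂)_{p(·,·|a₁,b₁)}, where p(·,·|a₁,b₁) denotes the conditional distribution of (A₂,B₂) given (A₁,B₁)=(a₁,b₁). -/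
open Finset in
/-- The quantity inside the logarithm of `Hdown` is nonnegative. -/
theorem condMoment_nonneg {A B : Type} [Fintype A] [Fintype B] (α : ℝ) {q : A → B → ℝ}
    (hq : ∀ a b, 0 ≤ q a b) :
    0 ≤ ∑ b, (∑ a, q a b) * ∑ a, (q a b / (∑ a', q a' b)) ^ α :=
  sum_nonneg fun b _ => mul_nonneg (sum_nonneg fun a _ => hq a b) <|
    sum_nonneg fun a _ => Real.rpow_nonneg (div_nonneg (hq a b) (sum_nonneg fun a _ => hq a b)) _

open Finset in
/-- The quantity inside the logarithm of `Hdown` is positive for a nonzero weight function. -/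
theorem condMoment_pos {A B : Type} [Fintype A] [Fintype B] (α : ℝ) {q : A → B → ℝ}
    (hq : ∀ a b, 0 ≤ q a b) {a : A} {b : B} (hab : 0 < q a b) :
    0 < ∑ b, (∑ a, q a b) * ∑ a, (q a b / (∑ a', q a' b)) ^ α := by
  have hnn : ∀ b, 0 ≤ ∑ a, q a b := fun b => sum_nonneg fun a _ => hq a b
  have hpow : ∀ a b, 0 ≤ (q a b / (∑ a', q a' b)) ^ α :=
    fun a b => Real.rpow_nonneg (div_nonneg (hq a b) (hnn b)) _
  have hmarg : 0 < ∑ a, q a b := sum_pos' (fun a _ => hq a b) ⟨a, mem_univ a, hab⟩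
  refine sum_pos' (fun b _ => mul_nonneg (hnn b) (sum_nonneg fun a _ => hpow a b))
    ⟨b, mem_univ b, mul_pos hmarg (sum_pos' (fun a _ => hpow a b) ⟨a, mem_univ a, ?_⟩)⟩
  exact Real.rpow_pos_of_pos (div_pos hab hmarg) _

open Finset in
/-- Chain rule for the moments when the marginal of `B₁ × B₂` is a product. -/
theorem condMoment_chain {A₁ B₁ A₂ B₂ : Type} [Fintype A₁] [Fintype B₁] [Fintype A₂] [Fintype B₂]
    (α : ℝ) {p : A₁ → B₁ → A₂ → B₂ → ℝ} {P : A₁ → B₁ → ℝ} {Q : B₂ → ℝ}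
    (hp0 : ∀ a₁ b₁ a₂ b₂, 0 ≤ p a₁ b₁ a₂ b₂) (hP : ∀ a₁ b₁, 0 ≤ P a₁ b₁) (hQ : ∀ b₂, 0 ≤ Q b₂)
    (hPQ : ∀ a₁ b₁ b₂, (∑ a₂, p a₁ b₁ a₂ b₂) = P a₁ b₁ * Q b₂) :
    (∑ b : B₁ × B₂, (∑ a : A₁ × A₂, p a.1 b.1 a.2 b.2) *
        ∑ a : A₁ × A₂, (p a.1 b.1 a.2 b.2 / ∑ a' : A₁ × A₂, p a'.1 b.1 a'.2 b.2) ^ α) =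
      ∑ b₁, (∑ a₁, P a₁ b₁) * ∑ a₁, (P a₁ b₁ / ∑ a₁', P a₁' b₁) ^ α *
        ∑ b₂, Q b₂ * ∑ a₂, (p a₁ b₁ a₂ b₂ / P a₁ b₁ / Q b₂) ^ α := by
  have hmarg : ∀ b₁ b₂, ∑ a : A₁ × A₂, p a.1 b₁ a.2 b₂ = (∑ a₁, P a₁ b₁) * Q b₂ := fun b₁ b₂ => by
    rw [Fintype.sum_prod_type, sum_mul]
    exact sum_congr rfl fun a₁ _ => hPQ a₁ b₁ b₂
  have hsplit : ∀ a₁ b₁ a₂ b₂, (p a₁ b₁ a₂ b₂ / ((∑ a₁, P a₁ b₁) * Q b₂)) ^ α =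
      (P a₁ b₁ / ∑ a₁', P a₁' b₁) ^ α * (p a₁ b₁ a₂ b₂ / P a₁ b₁ / Q b₂) ^ α := by
    intro a₁ b₁ a₂ b₂
    rw [← Real.mul_rpow (div_nonneg (hP _ _) (sum_nonneg fun _ _ => hP _ _))
      (div_nonneg (div_nonneg (hp0 _ _ _ _) (hP _ _)) (hQ _))]
    congr 1
    rcases (hP a₁ b₁).eq_or_lt with h | h
    · have hzero : p a₁ b₁ a₂ b₂ = 0 := by
        have hsum := hPQ a₁ b₁ b₂
        rw [← h, zero_mul, sum_eq_zero_iff_of_nonneg fun a₂ _ => hp0 a₁ b₁ a₂ b₂] at hsum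
        exact hsum a₂ (mem_univ a₂)
      simp [hzero]
    · rw [div_div, div_mul_div_comm, mul_left_comm, mul_div_mul_left _ _ h.ne']
  simp_rw [hmarg]
  rw [Fintype.sum_prod_type]
  refine sum_congr rfl fun b₁ _ => ?_
  simp_rw [Fintype.sum_prod_type, hsplit, mul_sum]
  rw [sum_comm]
  refine sum_congr rfl fun a₁ _ => sum_congr rfl fun b₂ _ => sum_congr rfl fun a₂ _ => ?_
  ring


/-- Un-optimized classical conditional Rényi entropy `H_α^↓(A|B)` of a joint
distribution `p`, where `p a b` is the probability of the pair `(a, b)`.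
Terms with zero marginal probability vanish automatically (with the conventions
`x / 0 = 0` and `0 ^ α = 0` for `α ≠ 0`). -/
noncomputable def Hdown (α : ℝ) {A B : Type} [Fintype A] [Fintype B] (p : A → B → ℝ) : ℝ :=
  (1 / (1 - α)) * Real.logb 2
    (∑ b, (∑ a, p a b) * ∑ a, (p a b / (∑ a', p a' b)) ^ α)

/-- If the side information `B₂` is generated independently of the past
`(A₁, B₁)`, i.e. the marginal of `p` on `A₁ × B₁ × B₂` factorizes as
`p(a₁,b₁,b₂) = p_{A₁B₁}(a₁,b₁) · p_{B₂}(b₂)`, then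
`H_α^↓(A₁A₂|B₁B₂)_p ≥ H_α^↓(A₁|B₁)_p + min_{(a₁,b₁) : p_{A₁B₁}(a₁,b₁)>0}
H_α^↓(A₂|B₂)_{p(·,·|a₁,b₁)}`. -/
theorem stmt0 {A₁ B₁ A₂ B₂ : Type} [Fintype A₁] [Fintype B₁] [Fintype A₂] [Fintype B₂]
    (α : ℝ) (hα : 1 < α)
    (p : A₁ → B₁ → A₂ → B₂ → ℝ)
    (hp0 : ∀ a₁ b₁ a₂ b₂, 0 ≤ p a₁ b₁ a₂ b₂)
    (hp1 : ∑ a₁, ∑ b₁, ∑ a₂, ∑ b₂, p a₁ b₁ a₂ b₂ = 1)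
    (hfact : ∀ a₁ b₁ b₂, (∑ a₂, p a₁ b₁ a₂ b₂) =
      (∑ a₂, ∑ b₂', p a₁ b₁ a₂ b₂') * (∑ a₁', ∑ b₁', ∑ a₂, p a₁' b₁' a₂ b₂)) :
    Hdown α (fun (a : A₁ × A₂) (b : B₁ × B₂) => p a.1 b.1 a.2 b.2) ≥
      Hdown α (fun a₁ b₁ => ∑ a₂, ∑ b₂, p a₁ b₁ a₂ b₂) +
      sInf {x : ℝ | ∃ a₁ b₁, 0 < (∑ a₂, ∑ b₂, p a₁ b₁ a₂ b₂) ∧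
        x = Hdown α (fun a₂ b₂ => p a₁ b₁ a₂ b₂ / (∑ a₂', ∑ b₂', p a₁ b₁ a₂' b₂'))} := by
  have hα' : 1 - α < 0 := by linarith
  set P : A₁ → B₁ → ℝ := fun a₁ b₁ => ∑ a₂, ∑ b₂, p a₁ b₁ a₂ b₂
  set Q : B₂ → ℝ := fun b₂ => ∑ a₁, ∑ b₁, ∑ a₂, p a₁ b₁ a₂ b₂
  have hP : ∀ a₁ b₁, 0 ≤ P a₁ b₁ := fun a₁ b₁ =>
    Finset.sum_nonneg fun _ _ => Finset.sum_nonneg fun _ _ => hp0 _ _ _ _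
  have hQ : ∀ b₂, 0 ≤ Q b₂ := fun b₂ => Finset.sum_nonneg fun _ _ =>
    Finset.sum_nonneg fun _ _ => Finset.sum_nonneg fun _ _ => hp0 _ _ _ _
  have hPQ : ∀ a₁ b₁ b₂, (∑ a₂, p a₁ b₁ a₂ b₂) = P a₁ b₁ * Q b₂ := hfact
  set S : Set ℝ := {x : ℝ | ∃ a₁ b₁, 0 < P a₁ b₁ ∧
    x = Hdown α (fun a₂ b₂ => p a₁ b₁ a₂ b₂ / P a₁ b₁)}
  change Hdown α (fun (a : A₁ × A₂) (b : B₁ × B₂) => p a.1 b.1 a.2 b.2) ≥ Hdown α P + sInf S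
  have hSbdd : BddBelow S := by
    refine ((Set.finite_range fun x : A₁ × B₁ =>
      Hdown α (fun a₂ b₂ => p x.1 x.2 a₂ b₂ / P x.1 x.2)).subset ?_).bddBelow
    rintro x ⟨a₁, b₁, -, rfl⟩
    exact ⟨(a₁, b₁), rfl⟩
  have hcond : ∀ a₁ b₁, 0 < P a₁ b₁ →
      ∑ b₂, Q b₂ * ∑ a₂, (p a₁ b₁ a₂ b₂ / P a₁ b₁ / Q b₂) ^ α ≤ 2 ^ ((1 - α) * sInf S) := by
    intro a₁ b₁ h
    have hle := csInf_le hSbdd (show Hdown α (fun a₂ b₂ => p a₁ b₁ a₂ b₂ / P a₁ b₁) ∈ S from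
      ⟨a₁, b₁, h, rfl⟩)
    have hnn := condMoment_nonneg α (q := fun a₂ b₂ => p a₁ b₁ a₂ b₂ / P a₁ b₁)
      fun a₂ b₂ => div_nonneg (hp0 _ _ _ _) h.le
    have hmarg : ∀ b₂, ∑ a₂, p a₁ b₁ a₂ b₂ / P a₁ b₁ = Q b₂ := fun b₂ => by
      rw [← Finset.sum_div, hPQ, mul_div_cancel_left₀ _ h.ne']
    simp only [Hdown, hmarg] at hle hnn
    rcases hnn.eq_or_lt with h0 | hpos
    · rw [← h0]
      positivity
    · rw [← Real.logb_le_iff_le_rpow one_lt_two hpos]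
      rwa [one_div_mul_eq_div, le_div_iff_of_neg' hα'] at hle
  have hpos : ∃ a₁ b₁ a₂ b₂, 0 < p a₁ b₁ a₂ b₂ := by
    by_contra! hneg
    have hzero : ∀ a₁ b₁ a₂ b₂, p a₁ b₁ a₂ b₂ = 0 := fun _ _ _ _ =>
      le_antisymm (hneg _ _ _ _) (hp0 _ _ _ _)
    simp [hzero] at hp1
  obtain ⟨a₁, b₁, a₂, b₂, hp⟩ := hpos
  have hjoint := condMoment_pos α (q := fun (a : A₁ × A₂) (b : B₁ × B₂) => p a.1 b.1 a.2 b.2)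
    (fun _ _ => hp0 _ _ _ _) (a := (a₁, a₂)) (b := (b₁, b₂)) hp
  have hchain := condMoment_chain α hp0 hP hQ hPQ
  have hle : (∑ b : B₁ × B₂, (∑ a : A₁ × A₂, p a.1 b.1 a.2 b.2) *
      ∑ a : A₁ × A₂, (p a.1 b.1 a.2 b.2 / ∑ a' : A₁ × A₂, p a'.1 b.1 a'.2 b.2) ^ α) ≤
      (∑ b₁, (∑ a₁, P a₁ b₁) * ∑ a₁, (P a₁ b₁ / ∑ a₁', P a₁' b₁) ^ α) *
        2 ^ ((1 - α) * sInf S) := by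
    rw [hchain, Finset.sum_mul]
    refine Finset.sum_le_sum fun b₁ _ => ?_
    rw [mul_assoc, Finset.sum_mul (f := fun a₁ => (P a₁ b₁ / ∑ a₁', P a₁' b₁) ^ α)]
    refine mul_le_mul_of_nonneg_left (Finset.sum_le_sum fun a₁ _ => ?_)
      (Finset.sum_nonneg fun _ _ => hP _ _)
    rcases (hP a₁ b₁).eq_or_lt with h | h
    · simp [← h, Real.zero_rpow (by linarith : α ≠ 0)]
    · exact mul_le_mul_of_nonneg_left (hcond a₁ b₁ h) (Real.rpow_nonneg
        (div_nonneg (hP _ _) (Finset.sum_nonneg fun _ _ => hP _ _)) _)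
  have hfirst := pos_of_mul_pos_left (hjoint.trans_le hle) (by positivity)
  have hlog := Real.logb_le_logb_of_le one_lt_two hjoint hle
  rw [Real.logb_mul hfirst.ne' (by positivity), Real.logb_rpow (by norm_num) (by norm_num)] at hlog
  simp only [Hdown, one_div_mul_eq_div]
  rw [ge_iff_le, le_div_iff_of_neg hα', add_mul, div_mul_cancel₀ _ hα'.ne, mul_comm (sInf S)]
  exact hlog
end

section
/- Let α = 3/2. Define g(0|0)=3/4, g(1|0)=1/4, g(0|1)=0, g(1|1)=1, and for r,b,a ∈ {0,1} define k(a|r,b) := 1/2 if r⊕b = 0 and k(a|r,b) := [a=0] if r⊕b = 1 (⊕ denotes XOR, [·] the indicator). Let p be the probability distribution on {0,1}⁴ given by p(a₁,b₁,a₂,b₂) := (1/4)·g(a₁|b₁)·k(a₂|a₁,b₂). Then H_α^↑(A₁A₂|B₁B₂)_p < H_α^↑(A₁|B₁)_p + (α/(1−α))·log((1/2)·2^{(1−α)/α} + 1/2). Equivalently, (1/4)·Σ_{b₁,b₂∈{0,1}} (Σ_{a₁,a₂∈{0,1}} g(a₁|b₁)^α·k(a₂|a₁,b₂)^α)^{1/α}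 > [(1/2)·((3/4)^α + (1/4)^α)^{1/α} + 1/2]·[(1/2)·2^{(1−α)/α} + 1/2]. (This is the explicit classical counterexample showing that the candidate chain rule with the optimized Rényi entropy H_α^↑ in every term fails.) -/
/-- Optimized classical conditional Rényi entropy `H_α^↑(A|B)` of a joint
distribution `p`, where `p a b` is the probability of the pair `(a, b)`.
Terms with zero marginal probability vanish automatically. -/
noncomputable def Hup (α : ℝ) {A B : Type} [Fintype A] [Fintype B] (p : A → B → ℝ) : ℝ :=
  (α / (1 - α)) * Real.logb 2
    (∑ b, (∑ a, p a b) * (∑ a, (p a b / (∑ a', p a' b)) ^ α) ^ (1 / α : ℝ))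

/-- The conditional distribution `g(a|b)`: `g(0|0)=3/4`, `g(1|0)=1/4`, `g(0|1)=0`,
`g(1|1)=1`, with `0 ↔ false` and `1 ↔ true`. -/
noncomputable def g : Bool → Bool → ℝ := fun a b =>
  if b = false then (if a = false then 3 / 4 else 1 / 4)
  else (if a = false then 0 else 1)

/-- The channel `k(a|r,b)`: `k(a|r,b) = 1/2` if `r ⊕ b = 0`, and `k(a|r,b) = [a = 0]`
if `r ⊕ b = 1`. -/
noncomputable def k : Bool → Bool → Bool → ℝ := fun a r b =>
  if r = b then 1 / 2 else (if a = false then 1 else 0)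

/-- The explicit counterexample distribution
`p(a₁,b₁,a₂,b₂) = (1/4)·g(a₁|b₁)·k(a₂|a₁,b₂)` on `{0,1}⁴`,
viewed as a joint distribution of `(a₁,a₂)` versus `(b₁,b₂)`. -/
noncomputable def pEx : Bool × Bool → Bool × Bool → ℝ := fun a b =>
  (1 / 4) * g a.1 b.1 * k a.2 a.1 b.2

theorem rpow_two_thirds_pow_three {x : ℝ} (hx : 0 ≤ x) : (x ^ (2 / 3 : ℝ)) ^ 3 = x ^ 2 := by
  rw [← Real.rpow_natCast, ← Real.rpow_mul hx, ← Real.rpow_natCast]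
  norm_num

theorem lt_rpow_two_thirds {c x : ℝ} (hx : 0 ≤ x) (h : c ^ 3 < x ^ 2) :
    c < x ^ (2 / 3 : ℝ) :=
  lt_of_pow_lt_pow_left₀ 3 (Real.rpow_nonneg hx _) (by rwa [rpow_two_thirds_pow_three hx])

theorem rpow_two_thirds_lt {c x : ℝ} (hc : 0 ≤ c) (hx : 0 ≤ x) (h : x ^ 2 < c ^ 3) :
    x ^ (2 / 3 : ℝ) < c :=
  lt_of_pow_lt_pow_left₀ 3 hc (by rwa [rpow_two_thirds_pow_three hx])

theorem rpow_three_halves_sq {x : ℝ} (hx : 0 ≤ x) : (x ^ (3 / 2 : ℝ)) ^ 2 = x ^ 3 := by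
  rw [← Real.rpow_natCast, ← Real.rpow_mul hx, ← Real.rpow_natCast]
  norm_num

theorem lt_rpow_three_halves {c x : ℝ} (hx : 0 ≤ x) (h : c ^ 2 < x ^ 3) :
    c < x ^ (3 / 2 : ℝ) :=
  lt_of_pow_lt_pow_left₀ 2 (Real.rpow_nonneg hx _) (by rwa [rpow_three_halves_sq hx])

theorem rpow_three_halves_lt {c x : ℝ} (hc : 0 ≤ c) (hx : 0 ≤ x) (h : x ^ 3 < c ^ 2) :
    x ^ (3 / 2 : ℝ) < c :=
  lt_of_pow_lt_pow_left₀ 2 hc (by rwa [rpow_three_halves_sq hx])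

theorem Hup_pEx : Hup (3 / 2) pEx = -3 * Real.logb 2 ((1 / 4) *
    ((2 * (3 / 8 : ℝ) ^ (3 / 2 : ℝ) + (1 / 4 : ℝ) ^ (3 / 2 : ℝ)) ^ (2 / 3 : ℝ) +
      ((3 / 4 : ℝ) ^ (3 / 2 : ℝ) + 2 * (1 / 8 : ℝ) ^ (3 / 2 : ℝ)) ^ (2 / 3 : ℝ) +
      1 + (2 * (1 / 2 : ℝ) ^ (3 / 2 : ℝ)) ^ (2 / 3 : ℝ))) := by
  have h0 : (0 : ℝ) ^ (3 / 2 : ℝ) = 0 := Real.zero_rpow (by norm_num)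
  unfold Hup
  congr 1
  · norm_num
  · congr 1
    simp [Fintype.sum_prod_type, pEx, g, k]
    norm_num [h0]
    ring_nf

theorem Hup_pEx_marginal :
    Hup (3 / 2) (fun a₁ b₁ => ∑ a₂, ∑ b₂, pEx (a₁, a₂) (b₁, b₂)) =
      -3 * Real.logb 2 ((1 / 2) *
        (((3 / 4 : ℝ) ^ (3 / 2 : ℝ) + (1 / 4 : ℝ) ^ (3 / 2 : ℝ)) ^ (2 / 3 : ℝ) + 1)) := by
  have h0 : (0 : ℝ) ^ (3 / 2 : ℝ) = 0 := Real.zero_rpow (by norm_num)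
  unfold Hup
  congr 1
  · norm_num
  · congr 1
    simp [pEx, g, k]
    norm_num [h0]
    ring_nf

/-- For `α = 3/2`, the explicit classical counterexample violates the
candidate chain rule with the optimized Rényi entropy `H_α^↑` in every term:
`H_α^↑(A₁A₂|B₁B₂)_p < H_α^↑(A₁|B₁)_p + (α/(1−α))·log((1/2)·2^{(1−α)/α} + 1/2)`. -/
theorem stmt1 :
    Hup (3 / 2) pEx <
      Hup (3 / 2) (fun a₁ b₁ => ∑ a₂, ∑ b₂, pEx (a₁, a₂) (b₁, b₂)) +
      ((3 / 2 : ℝ) / (1 - 3 / 2)) * Real.logb 2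
        ((1 / 2) * (2 : ℝ) ^ ((1 - 3 / 2) / (3 / 2) : ℝ) + 1 / 2) := by
  have e1 : (0.2296 : ℝ) < (3 / 8 : ℝ) ^ (3 / 2 : ℝ) :=
    lt_rpow_three_halves (by norm_num) (by norm_num)
  have e2 : (0.1249999 : ℝ) < (1 / 4 : ℝ) ^ (3 / 2 : ℝ) :=
    lt_rpow_three_halves (by norm_num) (by norm_num)
  have e2' : (1 / 4 : ℝ) ^ (3 / 2 : ℝ) < 0.1250001 :=
    rpow_three_halves_lt (by norm_num) (by norm_num) (by norm_num)
  have e3 : (0.6495 : ℝ) < (3 / 4 : ℝ) ^ (3 / 2 : ℝ) :=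
    lt_rpow_three_halves (by norm_num) (by norm_num)
  have e3' : (3 / 4 : ℝ) ^ (3 / 2 : ℝ) < 0.64952 :=
    rpow_three_halves_lt (by norm_num) (by norm_num) (by norm_num)
  have e4 : (0.04419 : ℝ) < (1 / 8 : ℝ) ^ (3 / 2 : ℝ) :=
    lt_rpow_three_halves (by norm_num) (by norm_num)
  have e5 : (0.35355 : ℝ) < (1 / 2 : ℝ) ^ (3 / 2 : ℝ) :=
    lt_rpow_three_halves (by norm_num) (by norm_num)
  have hX : (0.6986 : ℝ) <
      (2 * (3 / 8 : ℝ) ^ (3 / 2 : ℝ) + (1 / 4 : ℝ) ^ (3 / 2 : ℝ)) ^ (2 / 3 : ℝ) :=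
    lt_rpow_two_thirds (by linarith) (by nlinarith)
  have hY : (0.8165 : ℝ) <
      ((3 / 4 : ℝ) ^ (3 / 2 : ℝ) + 2 * (1 / 8 : ℝ) ^ (3 / 2 : ℝ)) ^ (2 / 3 : ℝ) :=
    lt_rpow_two_thirds (by linarith) (by nlinarith)
  have hT : (0.7936 : ℝ) < (2 * (1 / 2 : ℝ) ^ (3 / 2 : ℝ)) ^ (2 / 3 : ℝ) :=
    lt_rpow_two_thirds (by linarith) (by nlinarith)
  have hZ : ((3 / 4 : ℝ) ^ (3 / 2 : ℝ) + (1 / 4 : ℝ) ^ (3 / 2 : ℝ)) ^ (2 / 3 : ℝ) < 0.8434 :=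
    rpow_two_thirds_lt (by norm_num) (by linarith) (by nlinarith)
  have hZ0 : 0 ≤ ((3 / 4 : ℝ) ^ (3 / 2 : ℝ) + (1 / 4 : ℝ) ^ (3 / 2 : ℝ)) ^ (2 / 3 : ℝ) := by
    positivity
  have ht0 : 0 < (2 : ℝ) ^ ((1 - 3 / 2) / (3 / 2) : ℝ) := by positivity
  have ht : (2 : ℝ) ^ ((1 - 3 / 2) / (3 / 2) : ℝ) < 0.7938 := by
    refine lt_of_pow_lt_pow_left₀ 3 (by norm_num) ?_
    rw [← Real.rpow_natCast, ← Real.rpow_mul (by norm_num)]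
    norm_num [Real.rpow_neg_one]
  rw [Hup_pEx, Hup_pEx_marginal, show ((3 / 2 : ℝ) / (1 - 3 / 2)) = -3 by norm_num, ← mul_add,
    ← Real.logb_mul (by positivity) (by positivity)]
  refine mul_lt_mul_of_neg_left (Real.logb_lt_logb (by norm_num) (by positivity) ?_)
    (by norm_num)
  nlinarith
end

section
/- Let α ∈ (1,∞), let R, A, B be finite sets, let p_B be a probability distribution on B, and for every (r,b) ∈ R×B let m(·|r,b) be a probability distribution on A. For a finite set E and a probability distribution q on R×E, define the output distribution on A×B×E by p_q(a,b,e) := p_B(b)·Σ_r q(r,e)·m(a|r,b). Then the infimum over all finite sets E and all probability distributions q on R×E of H_α^↑(A|BE)_{p_q} equals (α/(1−α))·log( max_{r∈R} Σ_b p_B(b)·(Σ_a m(a|r,b)^α)^{1/α} ), and the infimum is attained by taking q to be a point mass on some (r,e). -/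
open scoped Classical

/-- The `ℓ^α` norm of a nonnegative vector. -/
noncomputable def alphaNorm (α : ℝ) {A : Type} [Fintype A] (f : A → ℝ) : ℝ :=
  (∑ a, f a ^ α) ^ (1 / α : ℝ)

section alphaNorm

variable {A : Type} [Fintype A] {α : ℝ}

lemma alphaNorm_nonneg {f : A → ℝ} (hf : ∀ a, 0 ≤ f a) : 0 ≤ alphaNorm α f :=
  Real.rpow_nonneg (Finset.sum_nonneg fun a _ => Real.rpow_nonneg (hf a) _) _

lemma alphaNorm_pos {f : A → ℝ} (hf : ∀ a, 0 ≤ f a) {a : A} (ha : 0 < f a) :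
    0 < alphaNorm α f :=
  Real.rpow_pos_of_pos (Finset.sum_pos' (fun a _ => Real.rpow_nonneg (hf a) _)
    ⟨a, Finset.mem_univ a, Real.rpow_pos_of_pos ha _⟩) _

lemma alphaNorm_zero (hα : α ≠ 0) : alphaNorm α (fun _ : A => (0 : ℝ)) = 0 := by
  simp [alphaNorm, Real.zero_rpow hα, Real.zero_rpow (inv_ne_zero hα)]

lemma alphaNorm_const_mul (hα : α ≠ 0) {c : ℝ} (hc : 0 ≤ c) {f : A → ℝ}
    (hf : ∀ a, 0 ≤ f a) : alphaNorm α (fun a => c * f a) = c * alphaNorm α f := by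
  have h : ∑ a, (c * f a) ^ α = c ^ α * ∑ a, f a ^ α := by
    rw [Finset.mul_sum]
    exact Finset.sum_congr rfl fun a _ => Real.mul_rpow hc (hf a)
  rw [alphaNorm, h, Real.mul_rpow (Real.rpow_nonneg hc _)
    (Finset.sum_nonneg fun a _ => Real.rpow_nonneg (hf a) _), ← Real.rpow_mul hc,
    mul_one_div_cancel hα, Real.rpow_one, alphaNorm]

/-- Minkowski's inequality for finite sums of nonnegative vectors. -/
lemma alphaNorm_sum_le (hα : 1 ≤ α) {ι : Type} (s : Finset ι) {f : ι → A → ℝ}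
    (hf : ∀ i a, 0 ≤ f i a) :
    alphaNorm α (fun a => ∑ i ∈ s, f i a) ≤ ∑ i ∈ s, alphaNorm α (f i) := by
  induction s using Finset.induction_on with
  | empty => simpa using (alphaNorm_zero (A := A) (by linarith : α ≠ 0)).le
  | insert i s hi ih =>
    simp only [Finset.sum_insert hi]
    exact (Real.Lp_add_le_of_nonneg Finset.univ hα (fun a _ => hf i a)
      fun a _ => Finset.sum_nonneg fun j _ => hf j a).trans (add_le_add_right ih _)

/-- The `ℓ^α` norm of a weight times that of its normalization is that of the weight. -/
lemma sum_mul_alphaNorm_div_sum (hα : α ≠ 0) {f : A → ℝ} (hf : ∀ a, 0 ≤ f a) :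
    (∑ a, f a) * alphaNorm α (fun a => f a / ∑ a', f a') = alphaNorm α f := by
  have hS : 0 ≤ ∑ a, f a := Finset.sum_nonneg fun a _ => hf a
  rw [← alphaNorm_const_mul hα hS fun a => div_nonneg (hf a) hS]
  congr 1
  funext a
  refine mul_div_cancel_of_imp' fun h => ?_
  exact (Finset.sum_eq_zero_iff_of_nonneg fun a _ => hf a).1 h a (Finset.mem_univ a)

lemma Hup_eq_logb_sum_alphaNorm {B : Type} [Fintype B] (hα : α ≠ 0) {p : A → B → ℝ}
    (hp : ∀ a b, 0 ≤ p a b) :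
    Hup α p = α / (1 - α) * Real.logb 2 (∑ b, alphaNorm α fun a => p a b) := by
  rw [Hup]
  congr 2
  exact Finset.sum_congr rfl fun b _ => sum_mul_alphaNorm_div_sum hα fun a => hp a b

end alphaNorm

section device

variable {R A B E : Type} [Fintype R] [Fintype A] [Fintype B] [Fintype E] {α : ℝ}
  {pB : B → ℝ} {m : A → R → B → ℝ} {q : R × E → ℝ}

/-- The output weights of a device have total mass one. -/
lemma sum_output (hpB1 : ∑ b, pB b = 1) (hm1 : ∀ r b, ∑ a, m a r b = 1)
    (hq1 : ∑ x, q x = 1) :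
    ∑ be : B × E, ∑ a, pB be.1 * ∑ r, q (r, be.2) * m a r be.1 = 1 := by
  have h (be : B × E) :
      ∑ a, pB be.1 * ∑ r, q (r, be.2) * m a r be.1 = pB be.1 * ∑ r, q (r, be.2) := by
    rw [← Finset.mul_sum, Finset.sum_comm]
    simp [← Finset.mul_sum, hm1]
  rw [Fintype.sum_prod_type_right] at hq1
  simp [h, Fintype.sum_prod_type, ← Finset.mul_sum, hq1, hpB1]

lemma sum_alphaNorm_output_pos (hpB0 : ∀ b, 0 ≤ pB b) (hpB1 : ∑ b, pB b = 1)
    (hm0 : ∀ a r b, 0 ≤ m a r b) (hm1 : ∀ r b, ∑ a, m a r b = 1)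
    (hq0 : ∀ x, 0 ≤ q x) (hq1 : ∑ x, q x = 1) :
    0 < ∑ be : B × E, alphaNorm α fun a => pB be.1 * ∑ r, q (r, be.2) * m a r be.1 := by
  have hp (a : A) (be : B × E) : 0 ≤ pB be.1 * ∑ r, q (r, be.2) * m a r be.1 :=
    mul_nonneg (hpB0 _) (Finset.sum_nonneg fun r _ => mul_nonneg (hq0 _) (hm0 _ _ _))
  have hpos : 0 < ∑ be : B × E, ∑ a, pB be.1 * ∑ r, q (r, be.2) * m a r be.1 := by
    rw [sum_output hpB1 hm1 hq1]
    exact one_pos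
  obtain ⟨be, -, hbe⟩ := Finset.exists_lt_of_sum_lt (s := Finset.univ)
    (f := fun _ : B × E => (0 : ℝ)) (by simpa using hpos)
  obtain ⟨a, -, ha⟩ := Finset.exists_lt_of_sum_lt (s := Finset.univ)
    (f := fun _ : A => (0 : ℝ)) (by simpa using hbe)
  exact Finset.sum_pos' (fun be _ => alphaNorm_nonneg fun a => hp a be)
    ⟨be, Finset.mem_univ be, alphaNorm_pos (fun a => hp a be) ha⟩

lemma sum_alphaNorm_output_le (hα : 1 ≤ α) (hpB0 : ∀ b, 0 ≤ pB b)
    (hm0 : ∀ a r b, 0 ≤ m a r b) (hq0 : ∀ x, 0 ≤ q x) (hq1 : ∑ x, q x = 1) :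
    ∑ be : B × E, alphaNorm α (fun a => pB be.1 * ∑ r, q (r, be.2) * m a r be.1) ≤
      ⨆ r, ∑ b, pB b * alphaNorm α fun a => m a r b := by
  have hα0 : α ≠ 0 := by linarith
  set M := ⨆ r, ∑ b, pB b * alphaNorm α fun a => m a r b
  have hnorm (be : B × E) : alphaNorm α (fun a => pB be.1 * ∑ r, q (r, be.2) * m a r be.1) ≤
      pB be.1 * ∑ r, q (r, be.2) * alphaNorm α fun a => m a r be.1 := by
    rw [alphaNorm_const_mul hα0 (hpB0 _)
      fun a => Finset.sum_nonneg fun r _ => mul_nonneg (hq0 _) (hm0 _ _ _)]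
    refine mul_le_mul_of_nonneg_left ?_ (hpB0 _)
    refine (alphaNorm_sum_le hα _ fun r a => mul_nonneg (hq0 (r, be.2)) (hm0 a r be.1)).trans ?_
    exact (Finset.sum_congr rfl fun r _ =>
      alphaNorm_const_mul hα0 (hq0 _) fun a => hm0 a r be.1).le
  calc _ ≤ ∑ be : B × E, pB be.1 * ∑ r, q (r, be.2) * alphaNorm α fun a => m a r be.1 :=
        Finset.sum_le_sum fun be _ => hnorm be
    _ = ∑ x : R × E, q x * ∑ b, pB b * alphaNorm α fun a => m a x.1 b := by
        simp only [Fintype.sum_prod_type_right, Finset.mul_sum]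
        refine Finset.sum_congr rfl fun e _ => ?_
        rw [Finset.sum_comm]
        exact Finset.sum_congr rfl fun r _ => Finset.sum_congr rfl fun b _ => by ring
    _ ≤ ∑ x : R × E, q x * M := by
        refine Finset.sum_le_sum fun x _ => mul_le_mul_of_nonneg_left ?_ (hq0 x)
        exact le_ciSup (f := fun r => ∑ b, pB b * alphaNorm α fun a => m a r b)
          (Set.finite_range _).bddAbove x.1
    _ = M := by rw [← Finset.sum_mul, hq1, one_mul]

end device

/-- For a classical device `m(·|r,b)` with memory values `r ∈ R` and
input `b` sampled from `p_B`, the infimum over all finite side-information sets `E` and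
all input distributions `q` on `R × E` of `H_α^↑(A|BE)` of the output distribution
`p_q(a,b,e) = p_B(b)·Σ_r q(r,e)·m(a|r,b)` equals
`(α/(1−α))·log(max_r Σ_b p_B(b)·(Σ_a m(a|r,b)^α)^{1/α})`, and it is attained by a
point mass on some `(r, e)`. -/
theorem stmt2 {R A B : Type} [Fintype R] [Nonempty R] [Fintype A] [Fintype B]
    (α : ℝ) (hα : 1 < α)
    (pB : B → ℝ) (hpB0 : ∀ b, 0 ≤ pB b) (hpB1 : ∑ b, pB b = 1)
    (m : A → R → B → ℝ) (hm0 : ∀ a r b, 0 ≤ m a r b) (hm1 : ∀ r b, ∑ a, m a r b = 1) :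
    (∀ (E : Type) [Fintype E], ∀ q : R × E → ℝ, (∀ x, 0 ≤ q x) → (∑ x, q x) = 1 →
      (α / (1 - α)) * Real.logb 2 (⨆ r, ∑ b, pB b * (∑ a, m a r b ^ α) ^ (1 / α : ℝ)) ≤
        Hup α (fun a (be : B × E) => pB be.1 * ∑ r, q (r, be.2) * m a r be.1)) ∧
    (∃ (E : Type) (_ : Fintype E) (r₀ : R) (e₀ : E),
      Hup α (fun a (be : B × E) =>
          pB be.1 * ∑ r, (if (r, be.2) = (r₀, e₀) then (1 : ℝ) else 0) * m a r be.1) =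
        (α / (1 - α)) * Real.logb 2 (⨆ r, ∑ b, pB b * (∑ a, m a r b ^ α) ^ (1 / α : ℝ))) := by
  have hα0 : α ≠ 0 := by linarith
  refine ⟨fun E _ q hq0 hq1 => ?_, ?_⟩
  · rw [Hup_eq_logb_sum_alphaNorm hα0 fun a be => mul_nonneg (hpB0 _)
      (Finset.sum_nonneg fun r _ => mul_nonneg (hq0 _) (hm0 _ _ _))]
    refine mul_le_mul_of_nonpos_left ?_ (div_nonpos_of_nonneg_of_nonpos (by linarith) (by linarith))
    exact Real.logb_le_logb_of_le one_lt_two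
      (sum_alphaNorm_output_pos hpB0 hpB1 hm0 hm1 hq0 hq1)
      (sum_alphaNorm_output_le hα.le hpB0 hm0 hq0 hq1)
  · obtain ⟨r₀, hr₀⟩ := exists_eq_ciSup_of_finite
      (f := fun r => ∑ b, pB b * (∑ a, m a r b ^ α) ^ (1 / α : ℝ))
    refine ⟨Unit, inferInstance, r₀, (), ?_⟩
    rw [← hr₀]
    simp only [Prod.mk.injEq, and_true, ite_mul, one_mul, zero_mul, Finset.sum_ite_eq',
      Finset.mem_univ, if_true]
    rw [Hup_eq_logb_sum_alphaNorm hα0 fun a be => mul_nonneg (hpB0 _) (hm0 _ _ _)]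
    congr 2
    simp only [Fintype.sum_prod_type, Finset.univ_unique, Finset.sum_singleton]
    exact Finset.sum_congr rfl fun b _ => alphaNorm_const_mul hα0 (hpB0 b) fun a => hm0 a r₀ b
end

section
/- Let α ∈ (1,∞), let B be a finite set, and let r : B → [0,∞) be not identically zero. For every probability distribution q on B with supp(r) ⊆ supp(q), Σ_b q(b)^{1−α}·r(b) ≥ (Σ_b r(b)^{1/α})^α, with equality for q*(b) := r(b)^{1/α} / Σ_{b'} r(b')^{1/α}. Consequently, the infimum of Σ_b q(b)^{1−α}·r(b) over all such probability distributions q equals (Σ_b r(b)^{1/α})^α. -/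
/-- Jensen's inequality for `x ↦ x ^ α`, with weights `q`. -/
lemma rpow_sum_rpow_one_div_le {B : Type*} [Fintype B] {α : ℝ} (hα : 1 < α) {r q : B → ℝ}
    (hr : ∀ b, 0 ≤ r b) (hq : ∀ b, 0 ≤ q b) (hq1 : ∑ b, q b = 1)
    (hsupp : ∀ b, r b ≠ 0 → q b ≠ 0) :
    (∑ b, r b ^ (1 / α : ℝ)) ^ α ≤ ∑ b, q b ^ (1 - α) * r b := by
  have hα0 : α ≠ 0 := by positivity
  have jensen := Real.rpow_arith_mean_le_arith_mean_rpow Finset.univ q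
    (fun b ↦ r b ^ (1 / α : ℝ) / q b) (fun b _ ↦ hq b) hq1
    (fun b _ ↦ div_nonneg (Real.rpow_nonneg (hr b) _) (hq b)) hα.le
  convert jensen using 1
  · congr 1
    refine Finset.sum_congr rfl fun b _ ↦ ?_
    by_cases hb : r b = 0
    · simp [hb, hα0]
    · rw [mul_div_cancel₀ _ (hsupp b hb)]
  · refine Finset.sum_congr rfl fun b _ ↦ ?_
    by_cases hb : r b = 0
    · simp [hb, hα0]
    · have hqb : 0 < q b := (hq b).lt_of_ne' (hsupp b hb)
      rw [Real.div_rpow (Real.rpow_nonneg (hr b) _) (hq b), ← Real.rpow_mul (hr b),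
        one_div_mul_cancel hα0, Real.rpow_one, Real.rpow_sub hqb, Real.rpow_one]
      ring

lemma sum_normalized_rpow_mul {B : Type*} [Fintype B] {α : ℝ} (hα : 1 < α) {r : B → ℝ}
    (hr : ∀ b, 0 ≤ r b) (hS : 0 < ∑ b, r b ^ (1 / α : ℝ)) :
    ∑ b, (r b ^ (1 / α : ℝ) / ∑ b', r b' ^ (1 / α : ℝ)) ^ (1 - α) * r b
      = (∑ b, r b ^ (1 / α : ℝ)) ^ α := by
  have hα0 : α ≠ 0 := by positivity
  set S := ∑ b, r b ^ (1 / α : ℝ) with hSdef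
  have hterm (b : B) :
      (r b ^ (1 / α : ℝ) / S) ^ (1 - α) * r b = r b ^ (1 / α : ℝ) * S ^ (α - 1) := by
    rcases (hr b).eq_or_lt with hb | hb
    · simp [← hb, hα0]
    · have hexp : r b ^ (1 / α * (1 - α)) * r b = r b ^ (1 / α : ℝ) := by
        rw [← Real.rpow_add_one hb.ne']
        congr 1
        field_simp
        ring
      rw [Real.div_rpow (by positivity) hS.le, ← Real.rpow_mul hb.le, div_mul_eq_mul_div, hexp,
        ← neg_sub α 1, Real.rpow_neg hS.le, div_inv_eq_mul]
  rw [Finset.sum_congr rfl fun b _ ↦ hterm b, ← Finset.sum_mul, ← hSdef,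
    mul_comm, ← Real.rpow_add_one hS.ne', sub_add_cancel]

/-- For `α ∈ (1,∞)`, a finite set `B`, and a nonnegative, not
identically zero function `r : B → [0,∞)`: every probability distribution `q` on `B`
with `supp(r) ⊆ supp(q)` satisfies `Σ_b q(b)^{1−α}·r(b) ≥ (Σ_b r(b)^{1/α})^α`, with
equality for `q*(b) = r(b)^{1/α} / Σ_{b'} r(b')^{1/α}`; consequently the infimum of
`Σ_b q(b)^{1−α}·r(b)` over all such `q` equals `(Σ_b r(b)^{1/α})^α`. -/
theorem stmt3 {B : Type} [Fintype B] (α : ℝ) (hα : 1 < α)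
    (r : B → ℝ) (hr0 : ∀ b, 0 ≤ r b) (hrne : ∃ b, r b ≠ 0) :
    (∀ q : B → ℝ, (∀ b, 0 ≤ q b) → (∑ b, q b) = 1 → (∀ b, r b ≠ 0 → q b ≠ 0) →
      (∑ b, r b ^ (1 / α : ℝ)) ^ α ≤ ∑ b, q b ^ (1 - α) * r b) ∧
    (∑ b, (r b ^ (1 / α : ℝ) / ∑ b', r b' ^ (1 / α : ℝ)) ^ (1 - α) * r b
        = (∑ b, r b ^ (1 / α : ℝ)) ^ α) ∧
    sInf {x : ℝ | ∃ q : B → ℝ, (∀ b, 0 ≤ q b) ∧ (∑ b, q b) = 1 ∧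
        (∀ b, r b ≠ 0 → q b ≠ 0) ∧ x = ∑ b, q b ^ (1 - α) * r b}
      = (∑ b, r b ^ (1 / α : ℝ)) ^ α := by
  have hS : 0 < ∑ b, r b ^ (1 / α : ℝ) := by
    obtain ⟨b, hb⟩ := hrne
    exact Finset.sum_pos' (fun b _ ↦ Real.rpow_nonneg (hr0 b) _)
      ⟨b, Finset.mem_univ b, Real.rpow_pos_of_pos ((hr0 b).lt_of_ne' hb) _⟩
  have heq := sum_normalized_rpow_mul hα hr0 hS
  refine ⟨fun q hq hq1 hsupp ↦ rpow_sum_rpow_one_div_le hα hr0 hq hq1 hsupp, heq,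
    IsLeast.csInf_eq ⟨⟨fun b ↦ r b ^ (1 / α : ℝ) / ∑ b', r b' ^ (1 / α : ℝ), ?_, ?_, ?_,
      heq.symm⟩, ?_⟩⟩
  · exact fun b ↦ div_nonneg (Real.rpow_nonneg (hr0 b) _) hS.le
  · rw [← Finset.sum_div, div_self hS.ne']
  · exact fun b hb ↦
      (div_pos (Real.rpow_pos_of_pos ((hr0 b).lt_of_ne' hb) _) hS).ne'
  · rintro x ⟨q, hq, hq1, hsupp, rfl⟩
    exact rpow_sum_rpow_one_div_le hα hr0 hq hq1 hsupp
end

section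
/- Let α ∈ (1,∞) and let p be a probability distribution on A×B×C (finite sets). For a probability distribution q on B with supp(p_B) ⊆ supp(q), set σ_q(b,c) := q(b)·p_{C|B}(c|b). Then the partially optimized conditional Rényi entropy satisfies the variational formula H_α(A|B↑C↓)_p = sup over all such q of −D_α(p ‖ 1_A⊗σ_q), where −D_α(p ‖ 1_A⊗σ_q) = (1/(1−α))·log( Σ_{a,b,c} p(a,b,c)^α·(q(b)·p_{C|B}(c|b))^{1−α} ), and the supremum is attained. -/
/-- Partially optimized classical conditional Rényi entropy `H_α(A|B↑C↓)` of a joint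
distribution `p` on `A × B × C`, where `p a b c` is the probability of `(a, b, c)`:
`H_α(A|B↑C↓)_p = (α/(1−α))·log(Σ_b p_B(b)·[Σ_c p_{C|B}(c|b)·Σ_a p_{A|BC}(a|b,c)^α]^{1/α})`. -/
noncomputable def Hpartial (α : ℝ) {A B C : Type} [Fintype A] [Fintype B] [Fintype C]
    (p : A → B → C → ℝ) : ℝ :=
  (α / (1 - α)) * Real.logb 2
    (∑ b, (∑ a, ∑ c, p a b c) *
      (∑ c, ((∑ a, p a b c) / (∑ a, ∑ c', p a b c')) *
        ∑ a, (p a b c / (∑ a', p a' b c)) ^ α) ^ (1 / α : ℝ))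

/-- Chain rule for one summand: `x = p(a,b,c)`, `r = p(b,c)`, `P = p(b)`. -/
lemma rpow_mul_rpow_one_sub_eq {α x r P q : ℝ} (hα : 1 < α) (hx : 0 ≤ x) (hxr : x ≤ r)
    (hrP : r ≤ P) (hq : 0 ≤ q) :
    x ^ α * (q * (r / P)) ^ (1 - α) = q ^ (1 - α) * P ^ α * (r / P * (x / r) ^ α) := by
  rcases (hx.trans hxr).eq_or_lt with hr | hr
  · have hx0 : x = 0 := le_antisymm (hr ▸ hxr) hx
    simp [hx0, ← hr, Real.zero_rpow (by linarith : α ≠ 0)]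
  have hP : 0 < P := hr.trans_le hrP
  have hu : 0 < r / P := div_pos hr hP
  have hx' : x = P * (r / P) * (x / r) := by field_simp
  have hpow : (r / P) ^ α * (r / P) ^ (1 - α) = r / P := by
    rw [← Real.rpow_add hu]; simp
  calc x ^ α * (q * (r / P)) ^ (1 - α)
      = (P * (r / P) * (x / r)) ^ α * (q * (r / P)) ^ (1 - α) := by rw [← hx']
    _ = q ^ (1 - α) * P ^ α * (((r / P) ^ α * (r / P) ^ (1 - α)) * (x / r) ^ α) := by
      rw [Real.mul_rpow (by positivity) (by positivity), Real.mul_rpow hP.le hu.le,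
        Real.mul_rpow hq hu.le]
      ring
    _ = _ := by rw [hpow]

lemma sum_rpow_le_sum_rpow_one_sub_mul_rpow {B : Type*} [Fintype B] {α : ℝ} (hα : 1 < α)
    {q w : B → ℝ} (hq : ∀ b, 0 ≤ q b) (hq1 : ∑ b, q b = 1) (hw : ∀ b, 0 ≤ w b)
    (hwq : ∀ b, w b ≠ 0 → q b ≠ 0) :
    (∑ b, w b) ^ α ≤ ∑ b, q b ^ (1 - α) * w b ^ α := by
  have hmean := Real.rpow_arith_mean_le_arith_mean_rpow Finset.univ q (fun b => w b / q b)
    (fun b _ => hq b) hq1 (fun b _ => div_nonneg (hw b) (hq b)) hα.le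
  convert hmean using 2
  · refine Finset.sum_congr rfl fun b _ => ?_
    by_cases h : q b = 0
    · simp [h, not_imp_not.1 (hwq b) h]
    · field_simp
  · rename_i b _
    by_cases h : q b = 0
    · simp [h, not_imp_not.1 (hwq b) h, Real.zero_rpow (by linarith : α ≠ 0)]
    · have hpos : 0 < q b := (hq b).lt_of_ne' h
      rw [Real.div_rpow (hw b) (hq b), Real.rpow_sub hpos, Real.rpow_one]
      ring

lemma sum_div_sum_rpow_one_sub_mul_rpow {B : Type*} [Fintype B] {α : ℝ} (hα : 1 < α)
    {w : B → ℝ} (hw : ∀ b, 0 ≤ w b) (hW : 0 < ∑ b, w b) :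
    ∑ b, (w b / ∑ b', w b') ^ (1 - α) * w b ^ α = (∑ b, w b) ^ α := by
  set W := ∑ b, w b
  have hterm : ∀ b, (w b / W) ^ (1 - α) * w b ^ α = w b * W ^ (α - 1) := by
    intro b
    rcases (hw b).eq_or_lt with h | h
    · simp [← h, Real.zero_rpow (by linarith : α ≠ 0)]
    · rw [Real.div_rpow h.le hW.le, div_mul_eq_mul_div, ← Real.rpow_add h,
        show α - 1 = -(1 - α) by ring, Real.rpow_neg hW.le]
      simp [div_eq_mul_inv]
  simp_rw [hterm]
  rw [← Finset.sum_mul, Real.rpow_sub hW, Real.rpow_one]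
  change W * _ = _
  field_simp

/-- **variational formula.** For a probability distribution `p` on
`A × B × C` and `α ∈ (1,∞)`, `H_α(A|B↑C↓)_p` equals the supremum, over probability
distributions `q` on `B` with `supp(p_B) ⊆ supp(q)`, of
`−D_α(p ‖ 1_A ⊗ σ_q) = (1/(1−α))·log(Σ_{a,b,c} p(a,b,c)^α·(q(b)·p_{C|B}(c|b))^{1−α})`,
where `σ_q(b,c) = q(b)·p_{C|B}(c|b)`; moreover the supremum is attained. -/
theorem stmt4 {A B C : Type} [Fintype A] [Fintype B] [Fintype C]
    (α : ℝ) (hα : 1 < α)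
    (p : A → B → C → ℝ) (hp0 : ∀ a b c, 0 ≤ p a b c)
    (hp1 : ∑ a, ∑ b, ∑ c, p a b c = 1) :
    (∀ q : B → ℝ, (∀ b, 0 ≤ q b) → (∑ b, q b) = 1 →
      (∀ b, (∑ a, ∑ c, p a b c) ≠ 0 → q b ≠ 0) →
      (1 / (1 - α)) * Real.logb 2
          (∑ a, ∑ b, ∑ c, p a b c ^ α *
            (q b * ((∑ a', p a' b c) / (∑ a', ∑ c', p a' b c'))) ^ (1 - α))
        ≤ Hpartial α p) ∧
    (∃ q : B → ℝ, (∀ b, 0 ≤ q b) ∧ (∑ b, q b) = 1 ∧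
      (∀ b, (∑ a, ∑ c, p a b c) ≠ 0 → q b ≠ 0) ∧
      (1 / (1 - α)) * Real.logb 2
          (∑ a, ∑ b, ∑ c, p a b c ^ α *
            (q b * ((∑ a', p a' b c) / (∑ a', ∑ c', p a' b c'))) ^ (1 - α))
        = Hpartial α p) := by
  have hα0 : α ≠ 0 := by linarith
  set P : B → ℝ := fun b => ∑ a, ∑ c, p a b c with hPdef
  set r : B → C → ℝ := fun b c => ∑ a, p a b c with hrdef
  set T : B → ℝ := fun b => ∑ c, (r b c / P b) * ∑ a, (p a b c / r b c) ^ α with hTdef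
  set w : B → ℝ := fun b => P b * T b ^ (1 / α) with hwdef
  have hr0 : ∀ b c, 0 ≤ r b c := fun b c => Finset.sum_nonneg fun a _ => hp0 a b c
  have hPr : ∀ b, P b = ∑ c, r b c := fun b => Finset.sum_comm
  have hP0 : ∀ b, 0 ≤ P b := fun b => hPr b ▸ Finset.sum_nonneg fun c _ => hr0 b c
  have hpr : ∀ a b c, p a b c ≤ r b c := fun a b c =>
    Finset.single_le_sum (f := fun a => p a b c) (fun a _ => hp0 a b c) (Finset.mem_univ a)
  have hrP : ∀ b c, r b c ≤ P b := fun b c => hPr b ▸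
    Finset.single_le_sum (fun c _ => hr0 b c) (Finset.mem_univ c)
  have hterm0 : ∀ b c, 0 ≤ (r b c / P b) * ∑ a, (p a b c / r b c) ^ α := fun b c =>
    mul_nonneg (div_nonneg (hr0 b c) (hP0 b)) <| Finset.sum_nonneg fun a _ =>
      Real.rpow_nonneg (div_nonneg (hp0 a b c) (hr0 b c)) α
  have hT0 : ∀ b, 0 ≤ T b := fun b => Finset.sum_nonneg fun c _ => hterm0 b c
  have hw0 : ∀ b, 0 ≤ w b := fun b => mul_nonneg (hP0 b) (Real.rpow_nonneg (hT0 b) _)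
  have hTpos : ∀ b, P b ≠ 0 → 0 < T b := by
    intro b hb
    obtain ⟨a, -, ha⟩ := Finset.exists_ne_zero_of_sum_ne_zero hb
    obtain ⟨c, -, hc⟩ := Finset.exists_ne_zero_of_sum_ne_zero ha
    have hpc : 0 < p a b c := (hp0 a b c).lt_of_ne' hc
    have hrc : 0 < r b c := hpc.trans_le (hpr a b c)
    refine Finset.sum_pos' (fun c _ => hterm0 b c) ⟨c, Finset.mem_univ c, ?_⟩
    refine mul_pos (div_pos hrc (hrc.trans_le (hrP b c))) ?_
    exact Finset.sum_pos' (fun a _ => Real.rpow_nonneg (div_nonneg (hp0 a b c) (hr0 b c)) α)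
      ⟨a, Finset.mem_univ a, Real.rpow_pos_of_pos (div_pos hpc hrc) α⟩
  have hwne : ∀ b, P b ≠ 0 → w b ≠ 0 := fun b hb =>
    mul_ne_zero hb (Real.rpow_pos_of_pos (hTpos b hb) _).ne'
  have hPw : ∀ b, w b ≠ 0 → P b ≠ 0 := fun b hb => left_ne_zero_of_mul hb
  have hW : 0 < ∑ b, w b := by
    have hP1 : ∑ b, P b ≠ 0 := by
      rw [Finset.sum_comm, hp1]
      exact one_ne_zero
    obtain ⟨b, -, hb⟩ := Finset.exists_ne_zero_of_sum_ne_zero hP1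
    exact Finset.sum_pos' (fun b _ => hw0 b)
      ⟨b, Finset.mem_univ b, (hw0 b).lt_of_ne' (hwne b hb)⟩
  have hS : ∀ q : B → ℝ, (∀ b, 0 ≤ q b) →
      ∑ a, ∑ b, ∑ c, p a b c ^ α * (q b * (r b c / P b)) ^ (1 - α)
        = ∑ b, q b ^ (1 - α) * w b ^ α := by
    intro q hq
    rw [Finset.sum_comm]
    refine Finset.sum_congr rfl fun b _ => ?_
    have hwα : w b ^ α = P b ^ α * T b := by
      rw [hwdef, Real.mul_rpow (hP0 b) (Real.rpow_nonneg (hT0 b) _), ← Real.rpow_mul (hT0 b),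
        one_div_mul_cancel hα0, Real.rpow_one]
    rw [hwα, ← mul_assoc, hTdef, Finset.sum_comm, Finset.mul_sum]
    refine Finset.sum_congr rfl fun c _ => ?_
    rw [Finset.mul_sum, Finset.mul_sum]
    exact Finset.sum_congr rfl fun a _ =>
      rpow_mul_rpow_one_sub_eq hα (hp0 a b c) (hpr a b c) (hrP b c) (hq b)
  have hH : Hpartial α p = 1 / (1 - α) * Real.logb 2 ((∑ b, w b) ^ α) := by
    rw [Real.logb_rpow_eq_mul_logb_of_pos hW, ← mul_assoc, one_div_mul_eq_div]
    rfl
  rw [hH]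
  refine ⟨fun q hq hq1 hsupp => ?_, fun b => w b / ∑ b', w b',
    fun b => div_nonneg (hw0 b) hW.le, ?_, fun b hb => div_ne_zero (hwne b hb) hW.ne', ?_⟩
  · rw [hS q hq]
    refine mul_le_mul_of_nonpos_left ?_ (one_div_nonpos.2 (by linarith))
    exact Real.logb_le_logb_of_le one_lt_two (Real.rpow_pos_of_pos hW α)
      (sum_rpow_le_sum_rpow_one_sub_mul_rpow hα hq hq1 hw0 fun b hb => hsupp b (hPw b hb))
  · rw [← Finset.sum_div, div_self hW.ne']
  · rw [hS _ fun b => div_nonneg (hw0 b) hW.le, sum_div_sum_rpow_one_sub_mul_rpow hα hw0 hW]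
end

section
/- Let α ∈ (1,∞) and let p be a probability distribution on A×B×C (finite sets). Then H_α^↓(A|BC)_p ≤ H_α(A|B↑C↓)_p ≤ H_α^↑(A|BC)_p, where H_α^↓(A|BC)_p = (1/(1−α))·log(Σ_{b,c} p_{BC}(b,c)·Σ_a p_{A|BC}(a|b,c)^α) and H_α^↑(A|BC)_p = (α/(1−α))·log(Σ_{b,c} p_{BC}(b,c)·(Σ_a p_{A|BC}(a|b,c)^α)^{1/α}); that is, the partially optimized conditional Rényi entropy lies between the un-optimized and the fully optimized conditional Rényi entropies. -/
open Finset in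
/-- Jensen's inequality for the concave function `x ↦ x ^ (1 / α)`, `1 ≤ α`. -/
theorem sum_mul_rpow_inv_le {ι : Type*} [Fintype ι] {α : ℝ} (hα : 1 ≤ α) (w z : ι → ℝ)
    (hw : ∀ i, 0 ≤ w i) (hw1 : ∑ i, w i = 1) (hz : ∀ i, 0 ≤ z i) :
    ∑ i, w i * z i ^ (1 / α) ≤ (∑ i, w i * z i) ^ (1 / α) := by
  have h := Real.arith_mean_le_rpow_mean univ w (fun i => z i ^ (1 / α)) (fun i _ => hw i) hw1
    (fun i _ => Real.rpow_nonneg (hz i) _) hα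
  have hpow : ∀ i, (z i ^ (1 / α)) ^ α = z i := fun i => by
    rw [← Real.rpow_mul (hz i), one_div_mul_cancel (by linarith), Real.rpow_one]
  simpa only [hpow] using h

/-- The optimized, partially optimized and un-optimized averages of a nonnegative `X` with respect
to a probability distribution `q` on `B × C` are increasing in this order. -/
theorem rpow_inv_averages {B C : Type*} [Fintype B] [Fintype C] {α : ℝ} (hα : 1 ≤ α)
    (q X : B → C → ℝ) (hq : ∀ b c, 0 ≤ q b c) (hq1 : ∑ b, ∑ c, q b c = 1)
    (hX : ∀ b c, 0 ≤ X b c) :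
    ∑ b, ∑ c, q b c * X b c ^ (1 / α) ≤
        ∑ b, (∑ c, q b c) * (∑ c, q b c / (∑ c', q b c') * X b c) ^ (1 / α) ∧
      ∑ b, (∑ c, q b c) * (∑ c, q b c / (∑ c', q b c') * X b c) ^ (1 / α) ≤
        (∑ b, ∑ c, q b c * X b c) ^ (1 / α) := by
  have hw : ∀ b, 0 ≤ ∑ c, q b c := fun b => Finset.sum_nonneg fun c _ => hq b c
  have hcancel : ∀ b c, (∑ c', q b c') * (q b c / ∑ c', q b c') = q b c := fun b c =>
    mul_div_cancel_of_imp' fun h =>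
      (Finset.sum_eq_zero_iff_of_nonneg fun c _ => hq b c).1 h c (Finset.mem_univ c)
  have hsum : ∀ (b : B) (Y : C → ℝ),
      ∑ c, q b c * Y c = (∑ c, q b c) * ∑ c, q b c / (∑ c', q b c') * Y c := fun b Y => by
    simp only [Finset.mul_sum, ← mul_assoc, hcancel]
  constructor
  · refine Finset.sum_le_sum fun b _ => ?_
    rw [hsum b fun c => X b c ^ (1 / α)]
    rcases (hw b).eq_or_lt with h | h
    · simp [← h]
    · refine mul_le_mul_of_nonneg_left ?_ h.le
      refine sum_mul_rpow_inv_le hα _ _ (fun c => div_nonneg (hq b c) h.le) ?_ (hX b)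
      rw [← Finset.sum_div, div_self h.ne']
  · simp only [hsum _ (X _)]
    exact sum_mul_rpow_inv_le hα _ _ hw hq1 fun b =>
      Finset.sum_nonneg fun c _ => mul_nonneg (div_nonneg (hq b c) (hw b)) (hX b c)

/-- The partially optimized conditional Rényi entropy lies between the
un-optimized and the fully optimized conditional Rényi entropies:
`H_α^↓(A|BC)_p ≤ H_α(A|B↑C↓)_p ≤ H_α^↑(A|BC)_p`. -/
theorem stmt5 {A B C : Type} [Fintype A] [Fintype B] [Fintype C]
    (α : ℝ) (hα : 1 < α)
    (p : A → B → C → ℝ) (hp0 : ∀ a b c, 0 ≤ p a b c)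
    (hp1 : ∑ a, ∑ b, ∑ c, p a b c = 1) :
    Hdown α (fun a (bc : B × C) => p a bc.1 bc.2) ≤ Hpartial α p ∧
    Hpartial α p ≤ Hup α (fun a (bc : B × C) => p a bc.1 bc.2) := by
  set q : B → C → ℝ := fun b c => ∑ a, p a b c with hq_def
  set X : B → C → ℝ := fun b c => ∑ a, (p a b c / q b c) ^ α with hX_def
  have hq : ∀ b c, 0 ≤ q b c := fun b c => Finset.sum_nonneg fun a _ => hp0 a b c
  have hX : ∀ b c, 0 ≤ X b c := fun b c =>
    Finset.sum_nonneg fun a _ => Real.rpow_nonneg (div_nonneg (hp0 a b c) (hq b c)) _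
  have hmarg : ∀ b, ∑ a, ∑ c, p a b c = ∑ c, q b c := fun b => Finset.sum_comm
  have hq1 : ∑ b, ∑ c, q b c = 1 := by
    simp only [← hmarg]
    rw [Finset.sum_comm, hp1]
  obtain ⟨hUS, hSD⟩ := rpow_inv_averages hα.le q X hq hq1 hX
  have hU : 0 < ∑ b, ∑ c, q b c * X b c ^ (1 / α) := by
    have hterm : ∀ b c, 0 ≤ q b c * X b c ^ (1 / α) := fun b c =>
      mul_nonneg (hq b c) (Real.rpow_nonneg (hX b c) _)
    obtain ⟨b, -, hb⟩ := Finset.exists_ne_zero_of_sum_ne_zero (hq1.trans_ne one_ne_zero)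
    obtain ⟨c, -, hc⟩ := Finset.exists_ne_zero_of_sum_ne_zero hb
    obtain ⟨a, -, ha⟩ := Finset.exists_ne_zero_of_sum_ne_zero hc
    have hqpos : 0 < q b c := (hq b c).lt_of_ne' hc
    have hXpos : 0 < X b c :=
      Finset.sum_pos' (fun a _ => Real.rpow_nonneg (div_nonneg (hp0 a b c) (hq b c)) _)
        ⟨a, Finset.mem_univ a, Real.rpow_pos_of_pos (div_pos ((hp0 a b c).lt_of_ne' ha) hqpos) _⟩
    exact Finset.sum_pos' (fun b _ => Finset.sum_nonneg fun c _ => hterm b c)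
      ⟨b, Finset.mem_univ b, Finset.sum_pos' (fun c _ => hterm b c)
        ⟨c, Finset.mem_univ c, mul_pos hqpos (Real.rpow_pos_of_pos hXpos _)⟩⟩
  have hS := hU.trans_le hUS
  have hD : 0 < ∑ b, ∑ c, q b c * X b c := by
    refine (Finset.sum_nonneg fun b _ => Finset.sum_nonneg fun c _ =>
      mul_nonneg (hq b c) (hX b c)).lt_of_ne' fun h => ?_
    rw [h, Real.zero_rpow (by positivity)] at hSD
    exact hS.not_ge hSD
  have hneg : α / (1 - α) ≤ 0 := div_nonpos_of_nonneg_of_nonpos (by linarith) (by linarith)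
  have hpartial : Hpartial α p = α / (1 - α) * Real.logb 2
      (∑ b, (∑ c, q b c) * (∑ c, q b c / (∑ c', q b c') * X b c) ^ (1 / α)) := by
    simp only [Hpartial, hmarg, hq_def, hX_def]
  have hdown : Hdown α (fun a (bc : B × C) => p a bc.1 bc.2) =
      α / (1 - α) * Real.logb 2 ((∑ b, ∑ c, q b c * X b c) ^ (1 / α)) := by
    rw [Real.logb_rpow_eq_mul_logb_of_pos hD, ← mul_assoc, Hdown, Fintype.sum_prod_type]
    congr 1
    field_simp
  have hup : Hup α (fun a (bc : B × C) => p a bc.1 bc.2) =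
      α / (1 - α) * Real.logb 2 (∑ b, ∑ c, q b c * X b c ^ (1 / α)) := by
    rw [Hup, Fintype.sum_prod_type]
  rw [hpartial, hdown, hup]
  exact ⟨mul_le_mul_of_nonpos_left (Real.logb_le_logb_of_le one_lt_two hS hSD) hneg,
    mul_le_mul_of_nonpos_left (Real.logb_le_logb_of_le one_lt_two hU hUS) hneg⟩
end

section
/- Let α ∈ (1,∞) and let p be a probability distribution on A×B×C×D (finite sets). Then H_α(AD|B↑C↓)_p ≥ H_α(A|B↑C↓)_p ≥ H_α(A|B↑(CD)↓)_p, where H_α(AD|B↑C↓)_p := (α/(1−α))·log(Σ_b p_B(b)·[Σ_c p_{C|B}(c|b)·Σ_{a,d} p_{AD|BC}(a,d|b,c)^α]^{1/α}) and H_α(A|B↑(CD)↓)_p := (α/(1−α))·log(Σ_b p_B(b)·[Σ_{c,d} p_{CD|B}(c,d|b)·Σ_a p_{A|BCD}(a|b,c,d)^α]^{1/α}). That is, adding a classical output register D cannot decrease the partially optimized conditional Rényi entropy, and adding D to the conditioning (down) register cannot increase it. -/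
open Finset in
/-- Superadditivity of `x ↦ x ^ α` on nonnegative reals, for finite sums. -/
theorem sum_rpow_le_rpow_sum {ι : Type*} (s : Finset ι) (f : ι → ℝ) (hf : ∀ i, 0 ≤ f i)
    {α : ℝ} (hα : 1 ≤ α) : ∑ i ∈ s, f i ^ α ≤ (∑ i ∈ s, f i) ^ α := by
  classical
  induction s using Finset.induction_on with
  | empty => simp [Real.zero_rpow (by linarith : α ≠ 0)]
  | insert i s hi ih =>
    rw [sum_insert hi, sum_insert hi]
    exact (add_le_add le_rfl ih).trans
      (Real.add_rpow_le_rpow_add (hf i) (sum_nonneg fun j _ => hf j) hα)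

open Finset in
/-- Joint convexity of the perspective of `x ↦ x ^ α`, in the form of a finite Jensen inequality. -/
theorem sum_mul_rpow_div_sum_le {ι : Type*} [Fintype ι] (s f : ι → ℝ) (hf : ∀ i, 0 ≤ f i)
    (hfs : ∀ i, f i ≤ s i) {α : ℝ} (hα : 1 ≤ α) :
    (∑ i, s i) * ((∑ i, f i) / ∑ i, s i) ^ α ≤ ∑ i, s i * (f i / s i) ^ α := by
  have hs : ∀ i, 0 ≤ s i := fun i => (hf i).trans (hfs i)
  rcases (sum_nonneg fun i _ => hs i : 0 ≤ ∑ i, s i).eq_or_lt with h | h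
  · rw [← h, zero_mul]
    exact sum_nonneg fun i _ => mul_nonneg (hs i) (Real.rpow_nonneg (div_nonneg (hf i) (hs i)) _)
  have key := Real.rpow_arith_mean_le_arith_mean_rpow univ (fun i => s i / ∑ j, s j)
    (fun i => f i / s i) (fun i _ => div_nonneg (hs i) h.le)
    (by rw [← sum_div, div_self h.ne']) (fun i _ => div_nonneg (hf i) (hs i)) hα
  have e1 : ∑ i, s i / (∑ j, s j) * (f i / s i) = (∑ i, f i) / ∑ i, s i := by
    rw [sum_div]
    refine sum_congr rfl fun i _ => ?_
    rcases (hs i).eq_or_lt with hi | hi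
    · have : f i = 0 := le_antisymm (hi ▸ hfs i) (hf i)
      simp [this]
    · field_simp
  rw [e1] at key
  calc _ ≤ (∑ i, s i) * ∑ i, s i / (∑ j, s j) * (f i / s i) ^ α :=
        mul_le_mul_of_nonneg_left key h.le
    _ = _ := by
        rw [mul_sum]
        refine sum_congr rfl fun i _ => ?_
        field_simp


/-- For a probability distribution `p` on `A × B × C × D` and
`α ∈ (1,∞)`, the partially optimized conditional Rényi entropy satisfies
`H_α(AD|B↑C↓)_p ≥ H_α(A|B↑C↓)_p ≥ H_α(A|B↑(CD)↓)_p`: adding a classical output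
register `D` cannot decrease it, and adding `D` to the conditioning (down) register
cannot increase it. -/
theorem stmt6 {A B C D : Type} [Fintype A] [Fintype B] [Fintype C] [Fintype D]
    (α : ℝ) (hα : 1 < α)
    (p : A → B → C → D → ℝ) (hp0 : ∀ a b c d, 0 ≤ p a b c d)
    (hp1 : ∑ a, ∑ b, ∑ c, ∑ d, p a b c d = 1) :
    ((α / (1 - α)) * Real.logb 2
        (∑ b, (∑ a, ∑ c, ∑ d, p a b c d) *
          (∑ c, ((∑ a, ∑ d, p a b c d) / (∑ a, ∑ c', ∑ d, p a b c' d)) *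
            ∑ a, (((∑ d, p a b c d) / (∑ a', ∑ d, p a' b c d)) ^ α)) ^ (1 / α : ℝ))
      ≤ (α / (1 - α)) * Real.logb 2
        (∑ b, (∑ a, ∑ c, ∑ d, p a b c d) *
          (∑ c, ((∑ a, ∑ d, p a b c d) / (∑ a, ∑ c', ∑ d, p a b c' d)) *
            ∑ a, ∑ d, ((p a b c d / (∑ a', ∑ d', p a' b c d')) ^ α)) ^ (1 / α : ℝ))) ∧
    ((α / (1 - α)) * Real.logb 2
        (∑ b, (∑ a, ∑ c, ∑ d, p a b c d) *
          (∑ c, ∑ d, ((∑ a, p a b c d) / (∑ a, ∑ c', ∑ d', p a b c' d')) *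
            ∑ a, ((p a b c d / (∑ a', p a' b c d)) ^ α)) ^ (1 / α : ℝ))
      ≤ (α / (1 - α)) * Real.logb 2
        (∑ b, (∑ a, ∑ c, ∑ d, p a b c d) *
          (∑ c, ((∑ a, ∑ d, p a b c d) / (∑ a, ∑ c', ∑ d, p a b c' d)) *
            ∑ a, (((∑ d, p a b c d) / (∑ a', ∑ d, p a' b c d)) ^ α)) ^ (1 / α : ℝ))) := by
  have nB : ∀ b, 0 ≤ ∑ a, ∑ c, ∑ d, p a b c d := fun b =>
    Finset.sum_nonneg fun a _ => Finset.sum_nonneg fun c _ => Finset.sum_nonneg fun d _ =>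
      hp0 a b c d
  have nBC : ∀ b c, 0 ≤ ∑ a, ∑ d, p a b c d := fun b c =>
    Finset.sum_nonneg fun a _ => Finset.sum_nonneg fun d _ => hp0 a b c d
  have nABC : ∀ a b c, 0 ≤ ∑ d, p a b c d := fun a b c =>
    Finset.sum_nonneg fun d _ => hp0 a b c d
  have hα0 : 0 < α := by linarith
  have hα' : 0 ≤ 1 / α := by positivity
  have nAD : ∀ b c, 0 ≤ ∑ a, ∑ d, ((p a b c d / (∑ a', ∑ d', p a' b c d')) ^ α) := fun b c =>
    Finset.sum_nonneg fun a _ => Finset.sum_nonneg fun d _ =>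
      Real.rpow_nonneg (div_nonneg (hp0 a b c d) (nBC b c)) _
  have nA : ∀ b c, 0 ≤ ∑ a, (((∑ d, p a b c d) / (∑ a', ∑ d, p a' b c d)) ^ α) := fun b c =>
    Finset.sum_nonneg fun a _ => Real.rpow_nonneg (div_nonneg (nABC a b c) (nBC b c)) _
  have hcoef : α / (1 - α) ≤ 0 := div_nonpos_of_nonneg_of_nonpos hα0.le (by linarith)
  have hpos : 0 < ∑ b, (∑ a, ∑ c, ∑ d, p a b c d) *
      (∑ c, ((∑ a, ∑ d, p a b c d) / (∑ a, ∑ c', ∑ d, p a b c' d)) *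
        ∑ a, ∑ d, ((p a b c d / (∑ a', ∑ d', p a' b c d')) ^ α)) ^ (1 / α : ℝ) := by
    have inner_nonneg : ∀ b c, 0 ≤ ((∑ a, ∑ d, p a b c d) / (∑ a, ∑ c', ∑ d, p a b c' d)) *
        ∑ a, ∑ d, ((p a b c d / (∑ a', ∑ d', p a' b c d')) ^ α) := fun b c =>
      mul_nonneg (div_nonneg (nBC b c) (nB b)) (nAD b c)
    obtain ⟨a, b, c, d, h⟩ : ∃ a b c d, 0 < p a b c d := by
      by_contra! hcon
      have h0 : ∀ a b c d, p a b c d = 0 := fun a b c d => le_antisymm (hcon a b c d) (hp0 a b c d)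
      simp [h0] at hp1
    have pABC : 0 < ∑ d, p a b c d :=
      Finset.sum_pos' (fun d _ => hp0 a b c d) ⟨d, Finset.mem_univ _, h⟩
    have pBC : 0 < ∑ a, ∑ d, p a b c d :=
      Finset.sum_pos' (fun a _ => nABC a b c) ⟨a, Finset.mem_univ _, pABC⟩
    have pB : 0 < ∑ a, ∑ c, ∑ d, p a b c d :=
      Finset.sum_pos' (fun a _ => Finset.sum_nonneg fun c _ => nABC a b c)
        ⟨a, Finset.mem_univ _,
          Finset.sum_pos' (fun c _ => nABC a b c) ⟨c, Finset.mem_univ _, pABC⟩⟩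
    have term_nonneg : ∀ a d, 0 ≤ (p a b c d / (∑ a', ∑ d', p a' b c d')) ^ α := fun a d =>
      Real.rpow_nonneg (div_nonneg (hp0 a b c d) (nBC b c)) _
    refine Finset.sum_pos' (fun b _ => mul_nonneg (nB b) (Real.rpow_nonneg
      (Finset.sum_nonneg fun c _ => inner_nonneg b c) _)) ⟨b, Finset.mem_univ _, ?_⟩
    refine mul_pos pB (Real.rpow_pos_of_pos ?_ _)
    refine Finset.sum_pos' (fun c _ => inner_nonneg b c) ⟨c, Finset.mem_univ _, ?_⟩
    refine mul_pos (div_pos pBC pB) (Finset.sum_pos'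
      (fun a _ => Finset.sum_nonneg fun d _ => term_nonneg a d) ⟨a, Finset.mem_univ _, ?_⟩)
    exact Finset.sum_pos' (fun d _ => term_nonneg a d)
      ⟨d, Finset.mem_univ _, Real.rpow_pos_of_pos (div_pos h pBC) _⟩
  have hle : (∑ b, (∑ a, ∑ c, ∑ d, p a b c d) *
      (∑ c, ((∑ a, ∑ d, p a b c d) / (∑ a, ∑ c', ∑ d, p a b c' d)) *
        ∑ a, ∑ d, ((p a b c d / (∑ a', ∑ d', p a' b c d')) ^ α)) ^ (1 / α : ℝ)) ≤
      ∑ b, (∑ a, ∑ c, ∑ d, p a b c d) *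
        (∑ c, ((∑ a, ∑ d, p a b c d) / (∑ a, ∑ c', ∑ d, p a b c' d)) *
          ∑ a, (((∑ d, p a b c d) / (∑ a', ∑ d, p a' b c d)) ^ α)) ^ (1 / α : ℝ) := by
    refine Finset.sum_le_sum fun b _ => mul_le_mul_of_nonneg_left (Real.rpow_le_rpow
      (Finset.sum_nonneg fun c _ => mul_nonneg (div_nonneg (nBC b c) (nB b)) (nAD b c))
      (Finset.sum_le_sum fun c _ => mul_le_mul_of_nonneg_left
        (Finset.sum_le_sum fun a _ => ?_) (div_nonneg (nBC b c) (nB b))) hα') (nB b)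
    rw [Finset.sum_div]
    exact sum_rpow_le_rpow_sum _ _ (fun d => div_nonneg (hp0 a b c d) (nBC b c)) hα.le
  refine ⟨mul_le_mul_of_nonpos_left (Real.logb_le_logb_of_le one_lt_two hpos hle) hcoef,
    mul_le_mul_of_nonpos_left
      (Real.logb_le_logb_of_le one_lt_two (hpos.trans_le hle) ?_) hcoef⟩
  refine Finset.sum_le_sum fun b _ => mul_le_mul_of_nonneg_left (Real.rpow_le_rpow
    (Finset.sum_nonneg fun c _ => mul_nonneg (div_nonneg (nBC b c) (nB b)) (nA b c))
    (Finset.sum_le_sum fun c _ => ?_) hα') (nB b)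
  simp only [div_mul_eq_mul_div]
  rw [← Finset.sum_div]
  refine div_le_div_of_nonneg_right ?_ (nB b)
  simp only [Finset.mul_sum (s := Finset.univ (α := A))]
  rw [Finset.sum_comm (s := Finset.univ (α := D))]
  refine Finset.sum_le_sum fun a _ => ?_
  rw [Finset.sum_comm (s := Finset.univ (α := A)) (t := Finset.univ (α := D))]
  exact sum_mul_rpow_div_sum_le (fun d => ∑ a, p a b c d) (fun d => p a b c d)
    (fun d => hp0 a b c d)
    (fun d => Finset.single_le_sum (f := fun a => p a b c d) (fun a _ => hp0 a b c d)
      (Finset.mem_univ a)) hα.le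
end

section
/- Let α ∈ (1,∞), let p be a probability distribution on A×B×C (finite sets), let N(ĉ|c) be a stochastic map from C to a finite set Ĉ (i.e., N(·|c) is a probability distribution on Ĉ for each c), and let p′(a,b,ĉ) := Σ_c p(a,b,c)·N(ĉ|c). Then H_α(A|B↑C↓)_p ≤ H_α(A|B↑Ĉ↓)_{p′}; that is, processing the down register C by a classical channel cannot decrease the partially optimized conditional Rényi entropy. -/
theorem sum_mul_rpow_div_le {C : Type} [Fintype C] {α : ℝ} (hα : 1 ≤ α) (w r : C → ℝ)
    (hw : ∀ c, 0 ≤ w c) (hr : ∀ c, 0 ≤ r c) :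
    (∑ c, w c) * ((∑ c, w c * r c) / ∑ c, w c) ^ α ≤ ∑ c, w c * r c ^ α := by
  rcases (Finset.sum_nonneg fun c _ => hw c : 0 ≤ ∑ c, w c).eq_or_lt with h | h
  · rw [← h, zero_mul]
    exact Finset.sum_nonneg fun c _ => mul_nonneg (hw c) (Real.rpow_nonneg (hr c) _)
  · have key := Real.rpow_arith_mean_le_arith_mean_rpow Finset.univ (fun c => w c / ∑ c, w c) r
      (fun c _ => div_nonneg (hw c) h.le) (by rw [← Finset.sum_div, div_self h.ne'])
      (fun c _ => hr c) hα
    simp only [div_mul_eq_mul_div, ← Finset.sum_div] at key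
    rwa [le_div_iff₀' h] at key

/-- The conditional `α`-moment does not increase under a channel on the conditioning register. -/
theorem sum_mul_sum_rpow_channel_le {A C Chat : Type} [Fintype A] [Fintype C] [Fintype Chat]
    {α : ℝ} (hα : 1 ≤ α) (p : A → C → ℝ) (hp : ∀ a c, 0 ≤ p a c)
    (N : Chat → C → ℝ) (hN0 : ∀ chat c, 0 ≤ N chat c) (hN1 : ∀ c, ∑ chat, N chat c = 1) :
    ∑ chat, (∑ a, ∑ c, p a c * N chat c) *
        ∑ a, ((∑ c, p a c * N chat c) / ∑ a', ∑ c, p a' c * N chat c) ^ α ≤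
      ∑ c, (∑ a, p a c) * ∑ a, (p a c / ∑ a', p a' c) ^ α := by
  have hq : ∀ c, 0 ≤ ∑ a, p a c := fun c => Finset.sum_nonneg fun a _ => hp a c
  have hmarg : ∀ chat, ∑ a, ∑ c, p a c * N chat c = ∑ c, (∑ a, p a c) * N chat c := by
    intro chat
    rw [Finset.sum_comm]
    simp only [Finset.sum_mul]
  have hcancel : ∀ a c, (∑ a', p a' c) * (p a c / ∑ a', p a' c) = p a c := by
    intro a c
    refine mul_div_cancel_of_imp' fun h => ?_
    exact (Finset.sum_eq_zero_iff_of_nonneg fun a _ => hp a c).1 h a (Finset.mem_univ a)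
  calc _ ≤ ∑ chat, ∑ a, ∑ c, ((∑ a', p a' c) * N chat c) * (p a c / ∑ a', p a' c) ^ α := by
        refine Finset.sum_le_sum fun chat _ => ?_
        rw [Finset.mul_sum]
        refine Finset.sum_le_sum fun a _ => ?_
        have key := sum_mul_rpow_div_le hα (fun c => (∑ a', p a' c) * N chat c)
          (fun c => p a c / ∑ a', p a' c) (fun c => mul_nonneg (hq c) (hN0 chat c))
          (fun c => div_nonneg (hp a c) (hq c))
        simp only [mul_right_comm _ (N chat _), hcancel] at key
        simpa only [hmarg, mul_right_comm _ (N chat _)] using key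
    _ = ∑ c, ∑ a, ∑ chat, ((∑ a', p a' c) * N chat c) * (p a c / ∑ a', p a' c) ^ α := by
        rw [Finset.sum_comm, Finset.sum_comm (s := (Finset.univ : Finset C))]
        exact Finset.sum_congr rfl fun a _ => Finset.sum_comm
    _ = _ := by
        refine Finset.sum_congr rfl fun c _ => ?_
        rw [Finset.mul_sum]
        refine Finset.sum_congr rfl fun a _ => ?_
        rw [← Finset.sum_mul, ← Finset.mul_sum, hN1, mul_one]

theorem sum_mul_rpow_sum_pos {A B C : Type} [Fintype A] [Fintype B] [Fintype C] (α : ℝ)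
    (p : A → B → C → ℝ) (hp0 : ∀ a b c, 0 ≤ p a b c) {a : A} {b : B} {c : C}
    (h : 0 < p a b c) :
    0 < ∑ b, (∑ a, ∑ c, p a b c) *
      (∑ c, ((∑ a, p a b c) / (∑ a, ∑ c', p a b c')) *
        ∑ a, (p a b c / (∑ a', p a' b c)) ^ α) ^ (1 / α : ℝ) := by
  have hq : ∀ b c, 0 ≤ ∑ a, p a b c := fun b c => Finset.sum_nonneg fun a _ => hp0 a b c
  have hr : ∀ b, 0 ≤ ∑ a, ∑ c, p a b c := fun b =>
    Finset.sum_nonneg fun a _ => Finset.sum_nonneg fun c _ => hp0 a b c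
  have hm : ∀ a b c, 0 ≤ (p a b c / ∑ a', p a' b c) ^ α := fun a b c =>
    Real.rpow_nonneg (div_nonneg (hp0 a b c) (hq b c)) _
  have ht : ∀ b c, 0 ≤ ((∑ a, p a b c) / (∑ a, ∑ c', p a b c')) *
      ∑ a, (p a b c / (∑ a', p a' b c)) ^ α := fun b c =>
    mul_nonneg (div_nonneg (hq b c) (hr b)) (Finset.sum_nonneg fun a _ => hm a b c)
  have hq' : 0 < ∑ a, p a b c :=
    Finset.sum_pos' (fun a _ => hp0 a b c) ⟨a, Finset.mem_univ a, h⟩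
  have hr' : 0 < ∑ a, ∑ c, p a b c :=
    Finset.sum_pos' (fun a _ => Finset.sum_nonneg fun c _ => hp0 a b c)
      ⟨a, Finset.mem_univ a,
        Finset.sum_pos' (fun c _ => hp0 a b c) ⟨c, Finset.mem_univ c, h⟩⟩
  refine Finset.sum_pos' (fun b _ => mul_nonneg (hr b)
    (Real.rpow_nonneg (Finset.sum_nonneg fun c _ => ht b c) _)) ⟨b, Finset.mem_univ b, ?_⟩
  refine mul_pos hr' (Real.rpow_pos_of_pos ?_ _)
  refine Finset.sum_pos' (fun c _ => ht b c) ⟨c, Finset.mem_univ c, ?_⟩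
  refine mul_pos (div_pos hq' hr') (Finset.sum_pos' (fun a _ => hm a b c)
    ⟨a, Finset.mem_univ a, Real.rpow_pos_of_pos (div_pos h hq') _⟩)


/-- **data processing for the down register.** Processing the down
register `C` with a classical channel `N(chat|c)` cannot decrease the partially
optimized conditional Rényi entropy: for `p′(a,b,chat) = Σ_c p(a,b,c)·N(chat|c)`,
`H_α(A|B↑C↓)_p ≤ H_α(A|B↑Chat↓)_{p′}`. -/
theorem stmt7 {A B C Chat : Type} [Fintype A] [Fintype B] [Fintype C] [Fintype Chat]
    (α : ℝ) (hα : 1 < α)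
    (p : A → B → C → ℝ) (hp0 : ∀ a b c, 0 ≤ p a b c)
    (hp1 : ∑ a, ∑ b, ∑ c, p a b c = 1)
    (N : Chat → C → ℝ) (hN0 : ∀ chat c, 0 ≤ N chat c) (hN1 : ∀ c, ∑ chat, N chat c = 1) :
    Hpartial α p ≤ Hpartial α (fun a b chat => ∑ c, p a b c * N chat c) := by
  have hp'0 : ∀ a b chat, 0 ≤ ∑ c, p a b c * N chat c := fun a b chat =>
    Finset.sum_nonneg fun c _ => mul_nonneg (hp0 a b c) (hN0 chat c)
  have hmarg : ∀ a b, ∑ chat, ∑ c, p a b c * N chat c = ∑ c, p a b c := by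
    intro a b
    rw [Finset.sum_comm]
    simp only [← Finset.mul_sum, hN1, mul_one]
  obtain ⟨a, b, chat, hpos⟩ : ∃ a b chat, 0 < ∑ c, p a b c * N chat c := by
    by_contra! hneg
    have hzero : ∑ a, ∑ b, ∑ c, p a b c ≤ 0 := by
      simp only [← hmarg]
      exact Finset.sum_nonpos fun a _ => Finset.sum_nonpos fun b _ =>
        Finset.sum_nonpos fun chat _ => hneg a b chat
    linarith
  unfold Hpartial
  refine mul_le_mul_of_nonpos_left ?_ (div_nonpos_of_nonneg_of_nonpos (by linarith) (by linarith))
  refine Real.logb_le_logb_of_le one_lt_two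
    (sum_mul_rpow_sum_pos α (fun a b chat => ∑ c, p a b c * N chat c) hp'0 hpos) ?_
  simp only [hmarg]
  refine Finset.sum_le_sum fun b _ => ?_
  have hr : 0 ≤ ∑ a, ∑ c, p a b c :=
    Finset.sum_nonneg fun a _ => Finset.sum_nonneg fun c _ => hp0 a b c
  refine mul_le_mul_of_nonneg_left (Real.rpow_le_rpow ?_ ?_ (by positivity)) hr
  · exact Finset.sum_nonneg fun chat _ => mul_nonneg
      (div_nonneg (Finset.sum_nonneg fun a _ => hp'0 a b chat) hr)
      (Finset.sum_nonneg fun a _ => Real.rpow_nonneg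
        (div_nonneg (hp'0 a b chat) (Finset.sum_nonneg fun a _ => hp'0 a b chat)) _)
  · simp only [div_mul_eq_mul_div, ← Finset.sum_div]
    exact div_le_div_of_nonneg_right (sum_mul_sum_rpow_channel_le hα.le (fun a c => p a b c)
      (fun a c => hp0 a b c) N hN0 hN1) hr
end

section
/- Let α ∈ (1,∞), let 𝒞 be a finite alphabet, let p be a probability distribution on A×B×C (finite sets, C with alphabet 𝒞), let σ be a nonnegative weight on B with supp(p_B) ⊆ supp(σ), let f ∈ ℝ^𝒞, let M ∈ ℝ, and for each c ∈ 𝒞 let τ_c be a probability distribution on a finite set D whose Rényi entropy H_α(τ_c) := (1/(1−α))·log(Σ_d τ_c(d)^α) equals M − f_c. Define the distribution p̄ on A×B×C×D by p̄(a,b,c,d) := p(a,b,c)·τ_c(d). Then H_α^f(AC|B)_{p|σ} = −D_α(p̄ ‖ 1_{ACD}⊗σ) − M, where (1_{ACD}⊗σ)(a,b,c,d) := σ(b). -/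
/-- Classical Rényi divergence of order `α` between a distribution `p` and a
nonnegative weight `q` on the same finite set:
`D_α(p‖q) = (1/(α−1))·log(Σ_x p(x)^α·q(x)^{1−α})`. -/
noncomputable def Dalpha (α : ℝ) {X : Type} [Fintype X] (p q : X → ℝ) : ℝ :=
  (1 / (α - 1)) * Real.logb 2 (∑ x, p x ^ α * q x ^ (1 - α))

/-- If `p` is nonnegative, not identically zero and supported in `supp q`, then the sum inside the
logarithm of the Rényi divergence is positive. -/
theorem sum_rpow_mul_rpow_pos {X : Type} [Fintype X] {p q : X → ℝ} (s t : ℝ)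
    (hp : ∀ x, 0 ≤ p x) (hq : ∀ x, 0 ≤ q x) (hpq : ∀ x, p x ≠ 0 → q x ≠ 0)
    (hne : ∑ x, p x ≠ 0) : 0 < ∑ x, p x ^ s * q x ^ t := by
  obtain ⟨x, -, hx⟩ := Finset.exists_ne_zero_of_sum_ne_zero hne
  refine Finset.sum_pos' (fun y _ => mul_nonneg (Real.rpow_nonneg (hp y) _)
    (Real.rpow_nonneg (hq y) _)) ⟨x, Finset.mem_univ x, ?_⟩
  exact mul_pos (Real.rpow_pos_of_pos (lt_of_le_of_ne (hp x) hx.symm) _)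
    (Real.rpow_pos_of_pos (lt_of_le_of_ne (hq x) (hpq x hx).symm) _)

/-- Exponentiating the Rényi divergence of a normalized nonnegative function recovers the
unnormalized power sum, weighted by `2 ^ ((α - 1) * r)`. -/
theorem sum_rpow_mul_two_rpow_Dalpha {X : Type} [Fintype X] {α : ℝ} (hα : 1 < α) {p q : X → ℝ}
    (hp : ∀ x, 0 ≤ p x) (hq : ∀ x, 0 ≤ q x) (hpq : ∀ x, p x ≠ 0 → q x ≠ 0) (r : ℝ) :
    (∑ x, p x) ^ α * (2 : ℝ) ^ ((α - 1) * (r + Dalpha α (fun x => p x / ∑ y, p y) q)) =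
      (2 : ℝ) ^ ((α - 1) * r) * ∑ x, p x ^ α * q x ^ (1 - α) := by
  have hα0 : α ≠ 0 := by linarith
  have hα1 : α - 1 ≠ 0 := by linarith
  by_cases hP : ∑ x, p x = 0
  · have h0 : ∀ x, p x = 0 := fun x =>
      (Finset.sum_eq_zero_iff_of_nonneg fun y _ => hp y).1 hP x (Finset.mem_univ x)
    simp [h0, Real.zero_rpow hα0]
  · have hPpos : 0 < ∑ x, p x :=
      lt_of_le_of_ne (Finset.sum_nonneg fun x _ => hp x) (Ne.symm hP)
    have hSpos := sum_rpow_mul_rpow_pos α (1 - α) hp hq hpq hP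
    have hPα := Real.rpow_pos_of_pos hPpos α
    have hdiv : ∑ x, (p x / ∑ y, p y) ^ α * q x ^ (1 - α) =
        (∑ x, p x ^ α * q x ^ (1 - α)) / (∑ y, p y) ^ α := by
      rw [Finset.sum_div]
      refine Finset.sum_congr rfl fun x _ => ?_
      rw [Real.div_rpow (hp x) hPpos.le]
      ring
    have hexp : (α - 1) * (r + Dalpha α (fun x => p x / ∑ y, p y) q) = (α - 1) * r +
        Real.logb 2 ((∑ x, p x ^ α * q x ^ (1 - α)) / (∑ y, p y) ^ α) := by
      rw [Dalpha, hdiv]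
      field_simp
    rw [hexp, Real.rpow_add two_pos,
      Real.rpow_logb two_pos (by norm_num) (div_pos hSpos hPα)]
    field_simp

/-- **divergence expression for the `f`-weighted Rényi entropy.**
Let `p` be a probability distribution on `A × B × C`, `σ` a nonnegative weight on `B`
with `supp(p_B) ⊆ supp(σ)`, `f ∈ ℝ^𝒞`, `M ∈ ℝ`, and for each `c` let `τ_c` be a
probability distribution on a finite set `D` with Rényi entropy
`H_α(τ_c) = (1/(1−α))·log(Σ_d τ_c(d)^α) = M − f_c`. Then, with
`p̄(a,b,c,d) = p(a,b,c)·τ_c(d)`, the `f`-weighted Rényi entropy satisfies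
`H_α^f(AC|B)_{p|σ} = −D_α(p̄ ‖ 1_{ACD}⊗σ) − M`. -/
theorem stmt9 {A B C D : Type} [Fintype A] [Fintype B] [Fintype C] [Fintype D]
    (α : ℝ) (hα : 1 < α)
    (p : A → B → C → ℝ) (hp0 : ∀ a b c, 0 ≤ p a b c)
    (hp1 : ∑ a, ∑ b, ∑ c, p a b c = 1)
    (σ : B → ℝ) (hσ0 : ∀ b, 0 ≤ σ b)
    (hσsupp : ∀ b, (∑ a, ∑ c, p a b c) ≠ 0 → σ b ≠ 0)
    (f : C → ℝ) (M : ℝ)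
    (τ : C → D → ℝ) (hτ0 : ∀ c d, 0 ≤ τ c d) (hτ1 : ∀ c, ∑ d, τ c d = 1)
    (hτH : ∀ c, (1 / (1 - α)) * Real.logb 2 (∑ d, τ c d ^ α) = M - f c) :
    (1 / (1 - α)) * Real.logb 2
        (∑ c, (∑ a, ∑ b, p a b c) ^ α *
          (2 : ℝ) ^ ((α - 1) * (f c +
            Dalpha α (fun x : A × B => p x.1 x.2 c / (∑ a, ∑ b, p a b c))
              (fun x : A × B => σ x.2))))
      = -(Dalpha α (fun x : A × B × C × D => p x.1 x.2.1 x.2.2.1 * τ x.2.2.1 x.2.2.2)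
            (fun x : A × B × C × D => σ x.2.1)) - M := by
  have hα1 : α - 1 ≠ 0 := by linarith
  have hα1' : 1 - α ≠ 0 := by linarith
  have hσp : ∀ a b c, p a b c ≠ 0 → σ b ≠ 0 := by
    intro a b c h
    refine hσsupp b fun h0 => h ?_
    have h1 := (Finset.sum_eq_zero_iff_of_nonneg fun a _ =>
      Finset.sum_nonneg fun c _ => hp0 a b c).1 h0 a (Finset.mem_univ a)
    exact (Finset.sum_eq_zero_iff_of_nonneg fun c _ => hp0 a b c).1 h1 c (Finset.mem_univ c)
  have hτsum : ∀ c, ∑ d, τ c d ^ α = (2 : ℝ) ^ ((1 - α) * (M - f c)) := by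
    intro c
    have hpos : 0 < ∑ d, τ c d ^ α := by
      simpa using sum_rpow_mul_rpow_pos (q := fun _ : D => (1 : ℝ)) α 0 (hτ0 c)
        (fun _ => zero_le_one) (fun _ _ => one_ne_zero) (by rw [hτ1 c]; exact one_ne_zero)
    have hlog : (1 - α) * (M - f c) = Real.logb 2 (∑ d, τ c d ^ α) := by
      rw [← hτH c]
      field_simp
    rw [hlog, Real.rpow_logb two_pos (by norm_num) hpos]
  have hterm : ∀ c, (∑ a, ∑ b, p a b c) ^ α * (2 : ℝ) ^ ((α - 1) * (f c +
      Dalpha α (fun x : A × B => p x.1 x.2 c / (∑ a, ∑ b, p a b c)) (fun x : A × B => σ x.2))) =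
      (2 : ℝ) ^ ((α - 1) * f c) * ∑ x : A × B, p x.1 x.2 c ^ α * σ x.2 ^ (1 - α) := by
    intro c
    have h := sum_rpow_mul_two_rpow_Dalpha hα (p := fun x : A × B => p x.1 x.2 c)
      (q := fun x => σ x.2) (fun x => hp0 _ _ _) (fun x => hσ0 _) (fun x => hσp _ _ _) (f c)
    have hsum : ∑ x : A × B, p x.1 x.2 c = ∑ a, ∑ b, p a b c := Fintype.sum_prod_type _
    rwa [hsum] at h
  have hbar : ∑ x : A × B × C × D,
      (p x.1 x.2.1 x.2.2.1 * τ x.2.2.1 x.2.2.2) ^ α * σ x.2.1 ^ (1 - α) =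
      (2 : ℝ) ^ ((1 - α) * M) * ∑ c, (2 : ℝ) ^ ((α - 1) * f c) *
        ∑ x : A × B, p x.1 x.2 c ^ α * σ x.2 ^ (1 - α) := by
    have hd : ∀ a b c, ∑ d, (p a b c * τ c d) ^ α * σ b ^ (1 - α) =
        (2 : ℝ) ^ ((1 - α) * M) * ((2 : ℝ) ^ ((α - 1) * f c) *
          (p a b c ^ α * σ b ^ (1 - α))) := by
      intro a b c
      have hsplit : (1 - α) * (M - f c) = (1 - α) * M + (α - 1) * f c := by ring
      simp_rw [Real.mul_rpow (hp0 a b c) (hτ0 c _)]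
      rw [← Finset.sum_mul, ← Finset.mul_sum, hτsum, hsplit, Real.rpow_add two_pos]
      ring
    simp_rw [Fintype.sum_prod_type, hd, Finset.mul_sum]
    conv_rhs => rw [Finset.sum_comm]
    exact Finset.sum_congr rfl fun a _ => Finset.sum_comm
  have hbar_pos : 0 < ∑ x : A × B × C × D,
      (p x.1 x.2.1 x.2.2.1 * τ x.2.2.1 x.2.2.2) ^ α * σ x.2.1 ^ (1 - α) := by
    refine sum_rpow_mul_rpow_pos (p := fun x : A × B × C × D =>
      p x.1 x.2.1 x.2.2.1 * τ x.2.2.1 x.2.2.2) (q := fun x => σ x.2.1) α (1 - α)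
      (fun x => mul_nonneg (hp0 _ _ _) (hτ0 _ _)) (fun x => hσ0 _)
      (fun x hx => hσp _ _ _ (left_ne_zero_of_mul hx)) ?_
    simp_rw [Fintype.sum_prod_type, ← Finset.mul_sum, hτ1, mul_one, hp1]
    exact one_ne_zero
  have hpow : (2 : ℝ) ^ ((1 - α) * M) ≠ 0 := (Real.rpow_pos_of_pos two_pos _).ne'
  rw [hbar] at hbar_pos
  have hsum_ne := right_ne_zero_of_mul hbar_pos.ne'
  rw [Finset.sum_congr rfl fun c _ => hterm c, Dalpha, hbar, Real.logb_mul hpow hsum_ne,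
    Real.logb_rpow two_pos (by norm_num), ← neg_sub α 1, one_div_neg_eq_neg_one_div]
  field_simp
  ring
end

section
/- Let α ∈ (1,∞), let 𝒞 be a finite alphabet, f ∈ ℝ^𝒞, let p be a probability distribution on A×C×B×E (finite sets), and let N(e′|e) be a stochastic map from E to a finite set E′. Define p′(a,c,b,e′) := Σ_e p(a,c,b,e)·N(e′|e). For a probability distribution q on B with supp(p_B) ⊆ supp(q), set σ_q(b,e) := q(b)·p_{E|B}(e|b) and σ′_q(b,e′) := q(b)·p′_{E′|B}(e′|b). Then sup_q H_α^f(AC|BE)_{p|σ_q} ≤ sup_q H_α^f(AC|BE′)_{p′|σ′_q}; that is, processing the side register E by a classical channel cannot decrease the optimized f-weighted Rényi entropy. -/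
/-- Classical `f`-weighted Rényi entropy `H_α^f(AC|BE)_{p|σ}` of a joint distribution
`p` on `A × C × B × E` relative to a weight `σ` on `B × E`:
`H_α^f(AC|BE)_{p|σ} = (1/(1−α))·log(Σ_c p_C(c)^α·2^{(α−1)·[f_c + D_α(p_{ABE|C=c} ‖ 1_A⊗σ)]})`. -/
noncomputable def Hf (α : ℝ) {A C B E : Type} [Fintype A] [Fintype C] [Fintype B] [Fintype E]
    (f : C → ℝ) (p : A → C → B → E → ℝ) (σ : B → E → ℝ) : ℝ :=
  (1 / (1 - α)) * Real.logb 2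
    (∑ c, (∑ a, ∑ b, ∑ e, p a c b e) ^ α *
      (2 : ℝ) ^ ((α - 1) * (f c +
        Dalpha α (fun x : A × B × E => p x.1 c x.2.1 x.2.2 / (∑ a, ∑ b, ∑ e, p a c b e))
          (fun x : A × B × E => σ x.2.1 x.2.2))))

section

open Finset

theorem csSup_le_csSup_of_forall_exists_le {X : Type*} [ConditionallyCompleteLattice X] {s t : Set X}
    (hs : s.Nonempty) (h : ∀ x ∈ s, ∃ y ∈ t, x ≤ y) (ht : BddAbove t) : sSup s ≤ sSup t :=
  csSup_le hs fun x hx =>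
    let ⟨_, hy, hxy⟩ := h x hx
    le_csSup_of_le ht hy hxy

/-- Hölder's inequality in the form of the joint subadditivity of `(x, y) ↦ x ^ α * y ^ (1 - α)`. -/
theorem rpow_sum_mul_rpow_sum_le {ι : Type*} (s : Finset ι) {α : ℝ} (hα : 1 < α) (x y : ι → ℝ)
    (hx : ∀ i, 0 ≤ x i) (hy : ∀ i, 0 ≤ y i) (hxy : ∀ i, x i ≠ 0 → y i ≠ 0) :
    (∑ i ∈ s, x i) ^ α * (∑ i ∈ s, y i) ^ (1 - α) ≤ ∑ i ∈ s, x i ^ α * y i ^ (1 - α) := by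
  have hα0 : 0 < α := by linarith
  have hterm : ∀ i, y i * (x i / y i) ^ α = x i ^ α * y i ^ (1 - α) := by
    intro i
    rcases (hy i).eq_or_lt with h | h
    · have hxi : x i = 0 := by
        by_contra h0
        exact hxy i h0 h.symm
      simp [hxi, Real.zero_rpow hα0.ne']
    · rw [Real.div_rpow (hx i) h.le, Real.rpow_sub h, Real.rpow_one]
      ring
  have hmul : ∀ i, y i * (x i / y i) = x i := by
    intro i
    by_cases h : y i = 0
    · have hxi : x i = 0 := by
        by_contra h0
        exact hxy i h0 h
      simp [hxi]
    · field_simp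
  have hS : 0 ≤ ∑ i ∈ s, x i ^ α * y i ^ (1 - α) := Finset.sum_nonneg fun i _ =>
    mul_nonneg (Real.rpow_nonneg (hx i) _) (Real.rpow_nonneg (hy i) _)
  have hX : 0 ≤ ∑ i ∈ s, x i := Finset.sum_nonneg fun i _ => hx i
  have hY : 0 ≤ ∑ i ∈ s, y i := Finset.sum_nonneg fun i _ => hy i
  have hH := Real.inner_le_weight_mul_Lp_of_nonneg s hα.le y (fun i => x i / y i) hy
    (fun i => div_nonneg (hx i) (hy i))
  simp only [hterm, hmul] at hH
  rcases hY.eq_or_lt with h | h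
  · rw [← h, Real.zero_rpow (by linarith), mul_zero]
    exact hS
  · have hpow := Real.rpow_le_rpow hX hH hα0.le
    rw [Real.mul_rpow (Real.rpow_nonneg hY _) (Real.rpow_nonneg hS _), ← Real.rpow_mul hY,
      ← Real.rpow_mul hS, inv_mul_cancel₀ hα0.ne', Real.rpow_one,
      show (1 - α⁻¹) * α = α - 1 by field_simp] at hpow
    calc _ ≤ ((∑ i ∈ s, y i) ^ (α - 1) * ∑ i ∈ s, x i ^ α * y i ^ (1 - α)) *
          (∑ i ∈ s, y i) ^ (1 - α) :=
          mul_le_mul_of_nonneg_right hpow (Real.rpow_nonneg hY _)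
      _ = ((∑ i ∈ s, y i) ^ (α - 1) * (∑ i ∈ s, y i) ^ (1 - α)) *
          ∑ i ∈ s, x i ^ α * y i ^ (1 - α) := by ring
      _ = _ := by rw [← Real.rpow_add h]; simp

/-- The sum inside the logarithm of the `f`-weighted Rényi entropy. -/
noncomputable def renyiSum (α : ℝ) {A C B E : Type} [Fintype A] [Fintype C] [Fintype B] [Fintype E]
    (f : C → ℝ) (p : A → C → B → E → ℝ) (σ : B → E → ℝ) : ℝ :=
  ∑ c, (2 : ℝ) ^ ((α - 1) * f c) * ∑ a, ∑ b, ∑ e, p a c b e ^ α * σ b e ^ (1 - α)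

variable {A C B E : Type} [Fintype A] [Fintype C] [Fintype E]

theorem Hf_eq_logb_renyiSum [Fintype B] {α : ℝ} (hα : 1 < α) (f : C → ℝ) (p : A → C → B → E → ℝ)
    (σ : B → E → ℝ) (hp : ∀ a c b e, 0 ≤ p a c b e) (hσ : ∀ b e, 0 ≤ σ b e)
    (hpσ : ∀ a c b e, p a c b e ≠ 0 → σ b e ≠ 0) :
    Hf α f p σ = (1 / (1 - α)) * Real.logb 2 (renyiSum α f p σ) := by
  have hα1 : α - 1 ≠ 0 := by linarith
  have hα0 : α ≠ 0 := by linarith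
  unfold Hf renyiSum
  congr 3
  funext c
  set P := ∑ a, ∑ b, ∑ e, p a c b e with hP
  have hP0 : 0 ≤ P := Finset.sum_nonneg fun a _ => Finset.sum_nonneg fun b _ =>
    Finset.sum_nonneg fun e _ => hp a c b e
  rcases hP0.eq_or_lt with h | h
  · have hz : ∀ a b e, p a c b e = 0 := by
      intro a b e
      have h1 := (Finset.sum_eq_zero_iff_of_nonneg fun a _ => Finset.sum_nonneg fun b _ =>
        Finset.sum_nonneg fun e _ => hp a c b e).1 h.symm a (mem_univ a)
      have h2 := (Finset.sum_eq_zero_iff_of_nonneg fun b _ =>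
        Finset.sum_nonneg fun e _ => hp a c b e).1 h1 b (mem_univ b)
      exact (Finset.sum_eq_zero_iff_of_nonneg fun e _ => hp a c b e).1 h2 e (mem_univ e)
    simp [← h, hz, Real.zero_rpow hα0]
  · have hsum : ∑ x : A × B × E, (p x.1 c x.2.1 x.2.2 / P) ^ α * σ x.2.1 x.2.2 ^ (1 - α) =
        (P ^ α)⁻¹ * ∑ a, ∑ b, ∑ e, p a c b e ^ α * σ b e ^ (1 - α) := by
      simp only [Fintype.sum_prod_type, Finset.mul_sum]
      refine Finset.sum_congr rfl fun a _ => Finset.sum_congr rfl fun b _ =>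
        Finset.sum_congr rfl fun e _ => ?_
      rw [Real.div_rpow (hp a c b e) hP0]
      ring
    have hpos : 0 < ∑ a, ∑ b, ∑ e, p a c b e ^ α * σ b e ^ (1 - α) := by
      obtain ⟨a, -, ha⟩ := Finset.exists_ne_zero_of_sum_ne_zero h.ne'
      obtain ⟨b, -, hb⟩ := Finset.exists_ne_zero_of_sum_ne_zero ha
      obtain ⟨e, -, he⟩ := Finset.exists_ne_zero_of_sum_ne_zero hb
      have hn : ∀ a b e, 0 ≤ p a c b e ^ α * σ b e ^ (1 - α) := fun a b e =>
        mul_nonneg (Real.rpow_nonneg (hp _ _ _ _) _) (Real.rpow_nonneg (hσ _ _) _)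
      refine Finset.sum_pos' (fun a _ => Finset.sum_nonneg fun b _ => Finset.sum_nonneg
        fun e _ => hn a b e) ⟨a, mem_univ a, ?_⟩
      refine Finset.sum_pos' (fun b _ => Finset.sum_nonneg
        fun e _ => hn a b e) ⟨b, mem_univ b, ?_⟩
      refine Finset.sum_pos' (fun e _ => hn a b e) ⟨e, mem_univ e, ?_⟩
      exact mul_pos (Real.rpow_pos_of_pos ((hp a c b e).lt_of_ne' he) _)
        (Real.rpow_pos_of_pos ((hσ b e).lt_of_ne' (hpσ a c b e he)) _)
    have hPα : 0 < P ^ α := Real.rpow_pos_of_pos h α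
    unfold Dalpha
    rw [hsum, mul_add, ← mul_assoc (α - 1), mul_one_div_cancel hα1, one_mul,
      Real.rpow_add two_pos, Real.rpow_logb two_pos (by norm_num) (by positivity)]
    field_simp

theorem renyiSum_pos [Fintype B] {α : ℝ} (f : C → ℝ) (p : A → C → B → E → ℝ)
    (σ : B → E → ℝ) (hp : ∀ a c b e, 0 ≤ p a c b e) (hσ : ∀ b e, 0 ≤ σ b e)
    (hpσ : ∀ a c b e, p a c b e ≠ 0 → σ b e ≠ 0) (hne : ∃ a c b e, p a c b e ≠ 0) :
    0 < renyiSum α f p σ := by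
  obtain ⟨a, c, b, e, he⟩ := hne
  have hn : ∀ a c b e, 0 ≤ p a c b e ^ α * σ b e ^ (1 - α) := fun a c b e =>
    mul_nonneg (Real.rpow_nonneg (hp _ _ _ _) _) (Real.rpow_nonneg (hσ _ _) _)
  unfold renyiSum
  refine Finset.sum_pos' (fun c _ => mul_nonneg (by positivity) (Finset.sum_nonneg fun a _ =>
    Finset.sum_nonneg fun b _ => Finset.sum_nonneg fun e _ => hn a c b e))
    ⟨c, mem_univ c, mul_pos (by positivity) ?_⟩
  refine Finset.sum_pos' (fun a _ => Finset.sum_nonneg fun b _ => Finset.sum_nonneg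
    fun e _ => hn a c b e) ⟨a, mem_univ a, ?_⟩
  refine Finset.sum_pos' (fun b _ => Finset.sum_nonneg
    fun e _ => hn a c b e) ⟨b, mem_univ b, ?_⟩
  refine Finset.sum_pos' (fun e _ => hn a c b e) ⟨e, mem_univ e, ?_⟩
  exact mul_pos (Real.rpow_pos_of_pos ((hp a c b e).lt_of_ne' he) _)
    (Real.rpow_pos_of_pos ((hσ b e).lt_of_ne' (hpσ a c b e he)) _)

theorem renyiSum_one_le [Fintype B] {α : ℝ} (hα : 1 < α) (f : C → ℝ) (p : A → C → B → E → ℝ)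
    (σ : B → E → ℝ) (hp : ∀ a c b e, 0 ≤ p a c b e) (hσ : ∀ b e, 0 ≤ σ b e)
    (hσ1 : ∀ b e, σ b e ≤ 1) (hpσ : ∀ a c b e, p a c b e ≠ 0 → σ b e ≠ 0) :
    renyiSum α f p (fun _ _ => 1) ≤ renyiSum α f p σ := by
  unfold renyiSum
  refine Finset.sum_le_sum fun c _ => mul_le_mul_of_nonneg_left ?_ (by positivity)
  refine Finset.sum_le_sum fun a _ => Finset.sum_le_sum fun b _ => Finset.sum_le_sum fun e _ => ?_
  by_cases h : p a c b e = 0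
  · simp [h, Real.zero_rpow (show α ≠ 0 by linarith)]
  · rw [Real.one_rpow]
    exact mul_le_mul_of_nonneg_left (Real.one_le_rpow_of_pos_of_le_one_of_nonpos
      ((hσ b e).lt_of_ne' (hpσ a c b e h)) (hσ1 b e) (by linarith))
      (Real.rpow_nonneg (hp _ _ _ _) _)

/-- The sum inside the logarithm decreases when a channel acts on the side register. -/
theorem renyiSum_channel_le {E' : Type} [Fintype B] [Fintype E'] {α : ℝ} (hα : 1 < α) (f : C → ℝ)
    (p : A → C → B → E → ℝ) (σ : B → E → ℝ) (N : E' → E → ℝ) (hp : ∀ a c b e, 0 ≤ p a c b e)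
    (hσ : ∀ b e, 0 ≤ σ b e) (hpσ : ∀ a c b e, p a c b e ≠ 0 → σ b e ≠ 0)
    (hN0 : ∀ e' e, 0 ≤ N e' e) (hN1 : ∀ e, ∑ e', N e' e = 1) :
    renyiSum α f (fun a c b e' => ∑ e, p a c b e * N e' e) (fun b e' => ∑ e, σ b e * N e' e) ≤
      renyiSum α f p σ := by
  unfold renyiSum
  refine Finset.sum_le_sum fun c _ => mul_le_mul_of_nonneg_left ?_ (by positivity)
  refine Finset.sum_le_sum fun a _ => Finset.sum_le_sum fun b _ => ?_
  calc _ ≤ ∑ e', ∑ e, (p a c b e * N e' e) ^ α * (σ b e * N e' e) ^ (1 - α) :=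
        Finset.sum_le_sum fun e' _ => rpow_sum_mul_rpow_sum_le univ hα _ _
          (fun e => mul_nonneg (hp a c b e) (hN0 e' e))
          (fun e => mul_nonneg (hσ b e) (hN0 e' e))
          (fun e h => mul_ne_zero (hpσ a c b e (left_ne_zero_of_mul h)) (right_ne_zero_of_mul h))
    _ = ∑ e, ∑ e', N e' e * (p a c b e ^ α * σ b e ^ (1 - α)) := by
        rw [Finset.sum_comm]
        refine Finset.sum_congr rfl fun e _ => Finset.sum_congr rfl fun e' _ => ?_
        rw [Real.mul_rpow (hp a c b e) (hN0 e' e), Real.mul_rpow (hσ b e) (hN0 e' e)]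
        have hN : N e' e ^ α * N e' e ^ (1 - α) = N e' e := by
          rw [← Real.rpow_add' (hN0 e' e) (by norm_num)]
          simp
        linear_combination (p a c b e ^ α * σ b e ^ (1 - α)) * hN
    _ = _ := by
        simp only [← Finset.sum_mul, hN1, one_mul]

/-- The weight `q_B · p_{E|B}`. -/
noncomputable def condWeight (p : A → C → B → E → ℝ) (q : B → ℝ) (b : B) (e : E) : ℝ :=
  q b * ((∑ a, ∑ c, p a c b e) / (∑ a, ∑ c, ∑ e'', p a c b e''))

theorem sum_marginal_swap (p : A → C → B → E → ℝ) (b : B) :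
    ∑ a, ∑ c, ∑ e, p a c b e = ∑ e, ∑ a, ∑ c, p a c b e := by
  simp only [Finset.sum_comm (s := (univ : Finset C)) (t := (univ : Finset E))]
  rw [Finset.sum_comm]

theorem condWeight_nonneg (p : A → C → B → E → ℝ) (hp : ∀ a c b e, 0 ≤ p a c b e) (q : B → ℝ)
    (hq : ∀ b, 0 ≤ q b) (b : B) (e : E) : 0 ≤ condWeight p q b e :=
  mul_nonneg (hq b) (div_nonneg
    (Finset.sum_nonneg fun a _ => Finset.sum_nonneg fun c _ => hp a c b e)
    (Finset.sum_nonneg fun a _ => Finset.sum_nonneg fun c _ =>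
      Finset.sum_nonneg fun e _ => hp a c b e))

theorem condWeight_le_one [Fintype B] (p : A → C → B → E → ℝ) (hp : ∀ a c b e, 0 ≤ p a c b e) (q : B → ℝ)
    (hq : ∀ b, 0 ≤ q b) (hq1 : ∑ b, q b = 1) (b : B) (e : E) : condWeight p q b e ≤ 1 := by
  have hn : ∀ e, 0 ≤ ∑ a, ∑ c, p a c b e := fun e =>
    Finset.sum_nonneg fun a _ => Finset.sum_nonneg fun c _ => hp a c b e
  refine mul_le_one₀ (hq1 ▸ Finset.single_le_sum (fun b _ => hq b) (mem_univ b)) ?_ ?_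
  · rw [sum_marginal_swap]
    exact div_nonneg (hn e) (Finset.sum_nonneg fun e _ => hn e)
  · rw [sum_marginal_swap]
    exact div_le_one_of_le₀ (Finset.single_le_sum (fun e _ => hn e) (mem_univ e))
      (Finset.sum_nonneg fun e _ => hn e)

theorem condWeight_ne_zero (p : A → C → B → E → ℝ) (hp : ∀ a c b e, 0 ≤ p a c b e) (q : B → ℝ)
    (hq : ∀ b, (∑ a, ∑ c, ∑ e, p a c b e) ≠ 0 → q b ≠ 0) (a : A) (c : C) (b : B) (e : E)
    (h : p a c b e ≠ 0) : condWeight p q b e ≠ 0 := by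
  have hn : ∀ e, 0 ≤ ∑ a, ∑ c, p a c b e := fun e =>
    Finset.sum_nonneg fun a _ => Finset.sum_nonneg fun c _ => hp a c b e
  have h1 : 0 < ∑ a, ∑ c, p a c b e :=
    Finset.sum_pos' (fun a _ => Finset.sum_nonneg fun c _ => hp a c b e) ⟨a, mem_univ a,
      Finset.sum_pos' (fun c _ => hp a c b e) ⟨c, mem_univ c, (hp a c b e).lt_of_ne' h⟩⟩
  have h2 : 0 < ∑ a, ∑ c, ∑ e, p a c b e := by
    rw [sum_marginal_swap]
    exact Finset.sum_pos' (fun e _ => hn e) ⟨e, mem_univ e, h1⟩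
  exact mul_ne_zero (hq b h2.ne') (div_pos h1 h2).ne'

theorem sum_channel {E' : Type} [Fintype E'] (g : E → ℝ) (N : E' → E → ℝ)
    (hN1 : ∀ e, ∑ e', N e' e = 1) : ∑ e', ∑ e, g e * N e' e = ∑ e, g e := by
  rw [Finset.sum_comm]
  simp only [← Finset.mul_sum, hN1, mul_one]

theorem condWeight_channel {E' : Type} [Fintype E'] (p : A → C → B → E → ℝ) (q : B → ℝ)
    (N : E' → E → ℝ) (hN1 : ∀ e, ∑ e', N e' e = 1) :
    condWeight (fun a c b e' => ∑ e, p a c b e * N e' e) q =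
      fun b e' => ∑ e, condWeight p q b e * N e' e := by
  funext b e'
  have hswap := sum_marginal_swap (fun a c b e => p a c b e * N e' e) b
  simp only [condWeight, sum_channel _ N hN1, hswap, ← Finset.sum_mul]
  rw [Finset.sum_div, Finset.mul_sum]
  refine Finset.sum_congr rfl fun e _ => ?_
  ring

end


/-- **data processing for the side register.** Processing the side
register `E` by a classical channel `N(e′|e)` cannot decrease the optimized
`f`-weighted Rényi entropy: with `p′(a,c,b,e′) = Σ_e p(a,c,b,e)·N(e′|e)`,
`σ_q(b,e) = q(b)·p_{E|B}(e|b)` and `σ′_q(b,e′) = q(b)·p′_{E′|B}(e′|b)`, one has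
`sup_q H_α^f(AC|BE)_{p|σ_q} ≤ sup_q H_α^f(AC|BE′)_{p′|σ′_q}`, the suprema being over
probability distributions `q` on `B` with `supp(p_B) ⊆ supp(q)`. -/
theorem stmt10 {A C B E E' : Type} [Fintype A] [Fintype C] [Fintype B] [Fintype E]
    [Fintype E']
    (α : ℝ) (hα : 1 < α) (f : C → ℝ)
    (p : A → C → B → E → ℝ) (hp0 : ∀ a c b e, 0 ≤ p a c b e)
    (hp1 : ∑ a, ∑ c, ∑ b, ∑ e, p a c b e = 1)
    (N : E' → E → ℝ) (hN0 : ∀ e' e, 0 ≤ N e' e) (hN1 : ∀ e, ∑ e', N e' e = 1) :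
    sSup {x : ℝ | ∃ q : B → ℝ, (∀ b, 0 ≤ q b) ∧ (∑ b, q b) = 1 ∧
        (∀ b, (∑ a, ∑ c, ∑ e, p a c b e) ≠ 0 → q b ≠ 0) ∧
        x = Hf α f p
          (fun b e => q b * ((∑ a, ∑ c, p a c b e) / (∑ a, ∑ c, ∑ e'', p a c b e'')))} ≤
    sSup {x : ℝ | ∃ q : B → ℝ, (∀ b, 0 ≤ q b) ∧ (∑ b, q b) = 1 ∧
        (∀ b, (∑ a, ∑ c, ∑ e, p a c b e) ≠ 0 → q b ≠ 0) ∧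
        x = Hf α f (fun a c b e' => ∑ e, p a c b e * N e' e)
          (fun b e' => q b * ((∑ a, ∑ c, ∑ e, p a c b e * N e' e) /
            (∑ a, ∑ c, ∑ e'', ∑ e, p a c b e * N e'' e)))} := by
  have hα0 : 1 / (1 - α) ≤ 0 := one_div_nonpos.2 (by linarith)
  set p' : A → C → B → E' → ℝ := fun a c b e' => ∑ e, p a c b e * N e' e with hp'
  have hp'0 : ∀ a c b e', 0 ≤ p' a c b e' := fun a c b e' =>
    Finset.sum_nonneg fun e _ => mul_nonneg (hp0 a c b e) (hN0 e' e)
  have hmarg : ∀ b, ∑ a, ∑ c, ∑ e', p' a c b e' = ∑ a, ∑ c, ∑ e, p a c b e := fun b => by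
    simp only [hp', sum_channel _ N hN1]
  have hp'1 : ∑ a, ∑ c, ∑ b, ∑ e', p' a c b e' = 1 := by
    simp only [hp', sum_channel _ N hN1, hp1]
  have hne' : ∃ a c b e', p' a c b e' ≠ 0 := by
    by_contra! h
    simp [h] at hp'1
  refine csSup_le_csSup_of_forall_exists_le ?_ ?_ ?_
  · refine ⟨_, fun b => ∑ a, ∑ c, ∑ e, p a c b e, fun b => Finset.sum_nonneg fun a _ =>
      Finset.sum_nonneg fun c _ => Finset.sum_nonneg fun e _ => hp0 a c b e, ?_,
      fun b hb => hb, rfl⟩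
    rw [← hp1, Finset.sum_comm]
    refine Finset.sum_congr rfl fun a _ => ?_
    rw [Finset.sum_comm]
  · rintro x ⟨q, hq0, hq1, hqs, rfl⟩
    refine ⟨_, ⟨q, hq0, hq1, hqs, rfl⟩, ?_⟩
    have hs := condWeight_ne_zero p hp0 q hqs
    have hn := condWeight_nonneg p hp0 q hq0
    have hs' := condWeight_ne_zero p' hp'0 q fun b hb => hqs b (hmarg b ▸ hb)
    have hn' := condWeight_nonneg p' hp'0 q hq0
    change Hf α f p (condWeight p q) ≤ Hf α f p' (condWeight p' q)
    rw [Hf_eq_logb_renyiSum hα f p _ hp0 hn hs, Hf_eq_logb_renyiSum hα f p' _ hp'0 hn' hs']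
    refine mul_le_mul_of_nonpos_left (Real.logb_le_logb_of_le one_lt_two
      (renyiSum_pos f p' _ hp'0 hn' hs' hne') ?_) hα0
    rw [hp', condWeight_channel p q N hN1]
    exact renyiSum_channel_le hα f p _ N hp0 hn hs hN0 hN1
  · refine ⟨1 / (1 - α) * Real.logb 2 (renyiSum α f p' fun _ _ => 1), ?_⟩
    rintro x ⟨q, hq0, hq1, hqs, rfl⟩
    have hs := condWeight_ne_zero p' hp'0 q fun b hb => hqs b (hmarg b ▸ hb)
    have hn := condWeight_nonneg p' hp'0 q hq0
    change Hf α f p' (condWeight p' q) ≤ _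
    rw [Hf_eq_logb_renyiSum hα f p' _ hp'0 hn hs]
    refine mul_le_mul_of_nonpos_left (Real.logb_le_logb_of_le one_lt_two ?_ ?_) hα0
    · exact renyiSum_pos f p' _ hp'0 (fun _ _ => zero_le_one) (fun _ _ _ _ _ => one_ne_zero) hne'
    · exact renyiSum_one_le hα f p' _ hp'0 hn (condWeight_le_one p' hp'0 q hq0 hq1) hs
end

section
/- Let α ∈ (1,∞), let 𝒞 be a finite set, let v and p be probability distributions on 𝒞 with v(c) > 0 and p(c) > 0 for all c ∈ 𝒞, and let d : 𝒞 → ℝ. Then sup over f ∈ ℝ^𝒞 of ( Σ_c v(c)·f_c + (1/(1−α))·log( Σ_c p(c)^α · 2^{(α−1)·(d(c) + f_c)} ) ) = (1/(α−1))·Σ_c v(c)·log( v(c)/p(c)^α ) − Σ_c v(c)·d(c), and the supremum is attained at f*_c := (1/(α−1))·log( v(c)/p(c)^α ) − d(c). -/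
/-- The Gibbs inequality for a positive probability vector `v` and positive weights `x`. -/
theorem sum_mul_logb_div_le_logb_sum {C : Type*} [Fintype C] {b : ℝ} (hb : 1 < b) {v x : C → ℝ}
    (hv : ∀ c, 0 < v c) (hv1 : ∑ c, v c = 1) (hx : ∀ c, 0 < x c) :
    ∑ c, v c * Real.logb b (x c / v c) ≤ Real.logb b (∑ c, x c) := by
  have jensen := strictConcaveOn_log_Ioi.concaveOn.le_map_sum (t := Finset.univ) (w := v)
    (p := fun c => x c / v c) (fun c _ => (hv c).le) hv1 (fun c _ => div_pos (hx c) (hv c))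
  simp only [Real.logb, ← mul_div_assoc, ← Finset.sum_div]
  have hlog := Real.log_pos hb
  have hsum : ∑ c, v c * (x c / v c) = ∑ c, x c :=
    Finset.sum_congr rfl fun c _ => mul_div_cancel₀ (x c) (hv c).ne'
  simp only [smul_eq_mul, hsum] at jensen
  gcongr

/-- **optimization over trade-off vectors.** For `α ∈ (1,∞)`, fully
supported probability distributions `v, p` on a finite set `𝒞` and `d : 𝒞 → ℝ`,
`sup_{f ∈ ℝ^𝒞} ( Σ_c v(c)·f_c + (1/(1−α))·log(Σ_c p(c)^α·2^{(α−1)(d(c)+f_c)}) )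
 = (1/(α−1))·Σ_c v(c)·log(v(c)/p(c)^α) − Σ_c v(c)·d(c)`,
and the supremum is attained at `f*_c = (1/(α−1))·log(v(c)/p(c)^α) − d(c)`. -/
theorem stmt12 {C : Type} [Fintype C]
    (α : ℝ) (hα : 1 < α)
    (v p : C → ℝ) (hv0 : ∀ c, 0 < v c) (hp0 : ∀ c, 0 < p c)
    (hv1 : ∑ c, v c = 1) (hp1 : ∑ c, p c = 1) (d : C → ℝ) :
    (∀ f : C → ℝ,
      (∑ c, v c * f c) +
          (1 / (1 - α)) * Real.logb 2
            (∑ c, p c ^ α * (2 : ℝ) ^ ((α - 1) * (d c + f c)))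
        ≤ (1 / (α - 1)) * (∑ c, v c * Real.logb 2 (v c / p c ^ α)) -
            ∑ c, v c * d c) ∧
    ((∑ c, v c * ((1 / (α - 1)) * Real.logb 2 (v c / p c ^ α) - d c)) +
          (1 / (1 - α)) * Real.logb 2
            (∑ c, p c ^ α * (2 : ℝ) ^ ((α - 1) *
              (d c + ((1 / (α - 1)) * Real.logb 2 (v c / p c ^ α) - d c))))
        = (1 / (α - 1)) * (∑ c, v c * Real.logb 2 (v c / p c ^ α)) -
            ∑ c, v c * d c) := by
  have hα' : 0 < α - 1 := sub_pos.mpr hα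
  have hpα c : 0 < p c ^ α := Real.rpow_pos_of_pos (hp0 c) α
  have hinv : 1 / (1 - α) = -(1 / (α - 1)) := by rw [← neg_sub α 1, one_div_neg_eq_neg_one_div]
  refine ⟨fun f => ?_, ?_⟩
  · have gibbs := sum_mul_logb_div_le_logb_sum one_lt_two hv0 hv1
      (x := fun c => p c ^ α * (2 : ℝ) ^ ((α - 1) * (d c + f c)))
      fun c => mul_pos (hpα c) (by positivity)
    have hterm c : v c * Real.logb 2 (p c ^ α * (2 : ℝ) ^ ((α - 1) * (d c + f c)) / v c) =
        (α - 1) * (v c * d c + v c * f c) - v c * Real.logb 2 (v c / p c ^ α) := by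
      rw [Real.logb_div (mul_pos (hpα c) (by positivity)).ne' (hv0 c).ne',
        Real.logb_mul (hpα c).ne' (by positivity), Real.logb_rpow two_pos (by norm_num),
        Real.logb_div (hv0 c).ne' (hpα c).ne']
      ring
    simp only [hterm, Finset.sum_sub_distrib, ← Finset.mul_sum, Finset.sum_add_distrib] at gibbs
    have scaled := mul_le_mul_of_nonneg_left gibbs (one_div_pos.mpr hα').le
    rw [mul_sub, ← mul_assoc, one_div_mul_cancel hα'.ne'] at scaled
    rw [hinv]
    linarith
  · have hterm c : p c ^ α * (2 : ℝ) ^ ((α - 1) *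
        (d c + ((1 / (α - 1)) * Real.logb 2 (v c / p c ^ α) - d c))) = v c := by
      rw [add_sub_cancel, ← mul_assoc, mul_one_div_cancel hα'.ne', one_mul,
        Real.rpow_logb two_pos (by norm_num) (div_pos (hv0 c) (hpα c)),
        mul_div_cancel₀ (v c) (hpα c).ne']
    simp only [hterm, hv1, Real.logb_one, mul_zero, add_zero, mul_sub, Finset.sum_sub_distrib,
      Finset.mul_sum, mul_left_comm]
end

section
/- Let α ∈ (1,∞); let R, A₁, B₁, A₂, B₂ be finite sets; let p_{B₂} be a probability distribution on B₂ and for each (r,b₂) ∈ R×B₂ let m(·|r,b₂) be a probability distribution on A₂ (so the classical channel r ↦ (a₂,b₂) outputs b₂ independently of its input). Let ω be a probability distribution on A₁×B₁×R and define the output distribution p(a₁,b₁,a₂,b₂) := Σ_r ω(a₁,b₁,r)·p_{B₂}(b₂)·m(a₂|r,b₂). Then H_α^↑(A₁A₂|B₁B₂)_p ≥ H_α^↑(A₁|B₁)_ω + inf over all finite sets E and all probability distributions ω′ on R×E of H_α(A₂|B₂↑E↓)_{p′}, where p′(a₂,b₂,e) := Σ_r ω′(r,e)·p_{B₂}(b₂)·m(a₂|r,b₂)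 and H_α(A₂|B₂↑E↓)_{p′} := (α/(1−α))·log( Σ_{b₂} p_{B₂}(b₂)·[ Σ_e p′_{E|B₂}(e|b₂)·Σ_{a₂} p′_{A₂|B₂E}(a₂|b₂,e)^α ]^{1/α} ). -/
/-- Partially optimized classical conditional Rényi entropy
`H_α(A₂|B₂↑E↓)_{p′} = (α/(1−α))·log(Σ_{b₂} p_{B₂}(b₂)·
[Σ_e p′_{E|B₂}(e|b₂)·Σ_{a₂} p′_{A₂|B₂E}(a₂|b₂,e)^α]^{1/α})`,
with the channel-input distribution `pB₂` in the outer average. -/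
noncomputable def HpartialOut (α : ℝ) {A₂ B₂ E : Type} [Fintype A₂] [Fintype B₂] [Fintype E]
    (pB₂ : B₂ → ℝ) (p' : A₂ → B₂ → E → ℝ) : ℝ :=
  (α / (1 - α)) * Real.logb 2
    (∑ b₂, pB₂ b₂ *
      (∑ e, ((∑ a₂, p' a₂ b₂ e) / (∑ a₂, ∑ e', p' a₂ b₂ e')) *
        ∑ a₂, (p' a₂ b₂ e / (∑ a₂', p' a₂' b₂ e)) ^ α) ^ (1 / α : ℝ))

open Finset Real

section HelperLemmas

variable {ι κ : Type*} [Fintype ι] [Fintype κ]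

lemma sum_mul_rpow_sum_div_rpow {α : ℝ} (hα : 1 < α) (f : ι → ℝ) (hf : ∀ i, 0 ≤ f i) :
    (∑ i, f i) * (∑ i, (f i / ∑ j, f j) ^ α) ^ (1 / α : ℝ) = (∑ i, f i ^ α) ^ (1 / α : ℝ) := by
  have hα0 : α ≠ 0 := by linarith
  have hs : 0 ≤ ∑ i, f i := sum_nonneg fun i _ => hf i
  rcases hs.eq_or_lt with h | h
  · have hz : ∀ i, f i = 0 := fun i =>
      (sum_eq_zero_iff_of_nonneg fun i _ => hf i).1 h.symm i (mem_univ i)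
    simp [hz, hα0]
  · have hsum : ∑ i, (f i / ∑ j, f j) ^ α = (∑ i, f i ^ α) / (∑ j, f j) ^ α := by
      rw [sum_div]
      exact sum_congr rfl fun i _ => div_rpow (hf i) hs α
    rw [hsum, div_rpow (sum_nonneg fun i _ => rpow_nonneg (hf i) α) (rpow_nonneg hs α), one_div,
      rpow_rpow_inv hs hα0]
    field_simp

lemma sum_div_sum_rpow_le_one {α : ℝ} (hα : 1 < α) (f : ι → ℝ) (hf : ∀ i, 0 ≤ f i) :
    ∑ i, (f i / ∑ j, f j) ^ α ≤ 1 := by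
  have hs : 0 ≤ ∑ i, f i := sum_nonneg fun i _ => hf i
  calc ∑ i, (f i / ∑ j, f j) ^ α ≤ ∑ i, f i / ∑ j, f j := by
        refine sum_le_sum fun i _ => rpow_le_self_of_le_one (div_nonneg (hf i) hs) ?_ hα.le
        exact div_le_one_of_le₀ (single_le_sum (fun i _ => hf i) (mem_univ i)) hs
    _ = (∑ i, f i) / ∑ j, f j := (sum_div _ _ _).symm
    _ ≤ 1 := div_self_le_one _

lemma sum_rpow_pos {α : ℝ} (f : ι → κ → ℝ) (hf : ∀ i j, 0 ≤ f i j)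
    (h : 0 < ∑ i, ∑ j, f i j) : 0 < ∑ j, (∑ i, f i j ^ α) ^ (1 / α : ℝ) := by
  have hn : ∀ j, 0 ≤ ∑ i, f i j ^ α := fun j => sum_nonneg fun i _ => rpow_nonneg (hf i j) α
  obtain ⟨i, -, hi⟩ :=
    (sum_pos_iff_of_nonneg fun i _ => sum_nonneg fun j _ => hf i j).1 h
  obtain ⟨j, -, hij⟩ := (sum_pos_iff_of_nonneg fun j _ => hf i j).1 hi
  refine sum_pos' (fun j _ => rpow_nonneg (hn j) _) ⟨j, mem_univ j, rpow_pos_of_pos ?_ _⟩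
  exact sum_pos' (fun i _ => rpow_nonneg (hf i j) α) ⟨i, mem_univ i, rpow_pos_of_pos hij α⟩

end HelperLemmas

lemma Hup_eq {α : ℝ} (hα : 1 < α) {A B : Type} [Fintype A] [Fintype B] (p : A → B → ℝ)
    (hp : ∀ a b, 0 ≤ p a b) :
    Hup α p = (α / (1 - α)) * logb 2 (∑ b, (∑ a, p a b ^ α) ^ (1 / α : ℝ)) := by
  unfold Hup
  congr 2
  exact sum_congr rfl fun b _ => sum_mul_rpow_sum_div_rpow hα (fun a => p a b) fun a => hp a b

lemma HpartialOut_nonneg {α : ℝ} (hα : 1 < α) {A₂ B₂ E : Type} [Fintype A₂] [Fintype B₂]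
    [Fintype E] (pB₂ : B₂ → ℝ) (hpB0 : ∀ b₂, 0 ≤ pB₂ b₂) (hpB1 : ∑ b₂, pB₂ b₂ = 1)
    (p : A₂ → B₂ → E → ℝ) (hp : ∀ a b e, 0 ≤ p a b e) : 0 ≤ HpartialOut α pB₂ p := by
  have hs : ∀ b e, 0 ≤ ∑ a, p a b e := fun b e => sum_nonneg fun a _ => hp a b e
  have ht : ∀ b, 0 ≤ ∑ a, ∑ e, p a b e := fun b =>
    sum_nonneg fun a _ => sum_nonneg fun e _ => hp a b e
  have hinner : ∀ b, 0 ≤ ∑ e, ((∑ a, p a b e) / (∑ a, ∑ e', p a b e')) *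
      ∑ a, (p a b e / (∑ a', p a' b e)) ^ α := fun b =>
    sum_nonneg fun e _ => mul_nonneg (div_nonneg (hs b e) (ht b))
      (sum_nonneg fun a _ => rpow_nonneg (div_nonneg (hp a b e) (hs b e)) α)
  refine mul_nonneg_of_nonpos_of_nonpos
    (div_nonpos_of_nonneg_of_nonpos (by linarith) (by linarith)) ?_
  refine logb_nonpos one_lt_two
    (sum_nonneg fun b _ => mul_nonneg (hpB0 b) (rpow_nonneg (hinner b) _)) ?_
  rw [← hpB1]
  refine sum_le_sum fun b _ => mul_le_of_le_one_right (hpB0 b) ?_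
  refine rpow_le_one (hinner b) ?_ (by positivity)
  calc _ ≤ ∑ e, (∑ a, p a b e) / (∑ a, ∑ e', p a b e') :=
        sum_le_sum fun e _ => mul_le_of_le_one_right (div_nonneg (hs b e) (ht b))
          (sum_div_sum_rpow_le_one hα (fun a => p a b e) fun a => hp a b e)
    _ = (∑ a, ∑ e', p a b e') / (∑ a, ∑ e', p a b e') := by rw [← sum_div, sum_comm]
    _ ≤ 1 := div_self_le_one _

/-- The partially optimized entropy of the channel output when the fixed register `E` carries
the escort distribution `w ^ α / ∑ w ^ α` of the marginal `w` of `ν`. -/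
lemma HpartialOut_escort {α : ℝ} (hα : 1 < α) {R E A₂ B₂ : Type} [Fintype R] [Fintype E]
    [Fintype A₂] [Fintype B₂] (pB₂ : B₂ → ℝ) (m : A₂ → R → B₂ → ℝ)
    (hm0 : ∀ a₂ r b₂, 0 ≤ m a₂ r b₂) (hm1 : ∀ r b₂, ∑ a₂, m a₂ r b₂ = 1)
    (ν : E → R → ℝ) (hν : ∀ e r, 0 ≤ ν e r) (hZ : 0 < ∑ e, (∑ r, ν e r) ^ α) :
    HpartialOut α pB₂ (fun a₂ b₂ e => ∑ r,
        ((∑ r', ν e r') ^ (α - 1) * ν e r / ∑ e', (∑ r', ν e' r') ^ α) * pB₂ b₂ * m a₂ r b₂) =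
      (α / (1 - α)) * logb 2
        ((∑ b₂, pB₂ b₂ * (∑ e, ∑ a₂, (∑ r, ν e r * m a₂ r b₂) ^ α) ^ (1 / α : ℝ)) /
          (∑ e, (∑ r, ν e r) ^ α) ^ (1 / α : ℝ)) := by
  have hα0 : α ≠ 0 := by linarith
  set w : E → ℝ := fun e => ∑ r, ν e r with hw
  set Z : ℝ := ∑ e, (∑ r, ν e r) ^ α with hZdef
  set g : A₂ → B₂ → E → ℝ := fun a b e => ∑ r, ν e r * m a r b with hg
  have hw0 : ∀ e, 0 ≤ w e := fun e => sum_nonneg fun r _ => hν e r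
  have hg0 : ∀ a b e, 0 ≤ g a b e := fun a b e =>
    sum_nonneg fun r _ => mul_nonneg (hν e r) (hm0 a r b)
  have hgsum : ∀ b e, ∑ a, g a b e = w e := by
    intro b e
    simp only [hg, hw]
    rw [sum_comm]
    simp [← mul_sum, hm1]
  have hpow : ∀ e, w e ^ (α - 1) * w e = w e ^ α := by
    intro e
    rcases (hw0 e).eq_or_lt with h | h
    · simp [← h, hα0]
    · rw [rpow_sub_one h.ne']
      field_simp
  have hp : ∀ a b e, ∑ r, (w e ^ (α - 1) * ν e r / Z) * pB₂ b * m a r b =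
      w e ^ (α - 1) / Z * pB₂ b * g a b e := by
    intro a b e
    simp only [hg, mul_sum]
    exact sum_congr rfl fun r _ => by ring
  have hps : ∀ b e, ∑ a, w e ^ (α - 1) / Z * pB₂ b * g a b e = w e ^ α / Z * pB₂ b := by
    intro b e
    rw [← mul_sum, hgsum, ← hpow]
    ring
  have hpt : ∀ b, ∑ a, ∑ e, w e ^ (α - 1) / Z * pB₂ b * g a b e = pB₂ b := by
    intro b
    rw [sum_comm]
    simp only [hps]
    rw [← sum_mul, ← sum_div]
    change Z / Z * _ = _
    rw [div_self hZ.ne', one_mul]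
  unfold HpartialOut
  change _ * logb 2 (∑ b, pB₂ b * (∑ e,
    ((∑ a, ∑ r, (w e ^ (α - 1) * ν e r / Z) * pB₂ b * m a r b) /
      (∑ a, ∑ e', ∑ r, (w e' ^ (α - 1) * ν e' r / Z) * pB₂ b * m a r b)) *
    ∑ a, ((∑ r, (w e ^ (α - 1) * ν e r / Z) * pB₂ b * m a r b) /
      (∑ a', ∑ r, (w e ^ (α - 1) * ν e r / Z) * pB₂ b * m a' r b)) ^ α) ^ (1 / α : ℝ)) = _
  simp only [hp, hps, hpt]
  congr 2
  rw [sum_div]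
  refine sum_congr rfl fun b _ => ?_
  rcases eq_or_ne (pB₂ b) 0 with hb | hb
  · simp [hb]
  rw [mul_div_assoc,
    ← div_rpow (sum_nonneg fun e _ => sum_nonneg fun a _ => rpow_nonneg (hg0 a b e) α) hZ.le,
    sum_div]
  congr 2
  refine sum_congr rfl fun e _ => ?_
  rcases (hw0 e).eq_or_lt with h | h
  · have hz : ∀ a, g a b e = 0 := fun a =>
      (sum_eq_zero_iff_of_nonneg fun a _ => hg0 a b e).1 ((hgsum b e).trans h.symm) a (mem_univ a)
    simp [← h, hz, hα0]
  · have hwα : 0 < w e ^ α := rpow_pos_of_pos h α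
    have hq : ∀ a, (w e ^ (α - 1) / Z * pB₂ b * g a b e / (w e ^ α / Z * pB₂ b)) ^ α =
        g a b e ^ α / w e ^ α := by
      intro a
      rw [← div_rpow (hg0 a b e) h.le, rpow_sub_one h.ne']
      congr 1
      field_simp
    simp only [hq]
    rw [← sum_div]
    field_simp

/-- **classical instance of the new chain rule.** For a classical
channel `r ↦ (a₂, b₂)` whose fresh side information `b₂` is sampled from `p_{B₂}`
independently of its input, and any input distribution `ω` on `A₁ × B₁ × R`,
the output `p(a₁,b₁,a₂,b₂) = Σ_r ω(a₁,b₁,r)·p_{B₂}(b₂)·m(a₂|r,b₂)` satisfies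
`H_α^↑(A₁A₂|B₁B₂)_p ≥ H_α^↑(A₁|B₁)_ω + inf_{E, ω'} H_α(A₂|B₂↑E↓)_{p′}`, the infimum
being over all finite sets `E` and distributions `ω'` on `R × E`, where
`p′(a₂,b₂,e) = Σ_r ω'(r,e)·p_{B₂}(b₂)·m(a₂|r,b₂)`. -/
theorem stmt15 {R A₁ B₁ A₂ B₂ : Type}
    [Fintype R] [Fintype A₁] [Fintype B₁] [Fintype A₂] [Fintype B₂]
    (α : ℝ) (hα : 1 < α)
    (pB₂ : B₂ → ℝ) (hpB0 : ∀ b₂, 0 ≤ pB₂ b₂) (hpB1 : ∑ b₂, pB₂ b₂ = 1)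
    (m : A₂ → R → B₂ → ℝ) (hm0 : ∀ a₂ r b₂, 0 ≤ m a₂ r b₂)
    (hm1 : ∀ r b₂, ∑ a₂, m a₂ r b₂ = 1)
    (ω : A₁ → B₁ → R → ℝ) (hω0 : ∀ a₁ b₁ r, 0 ≤ ω a₁ b₁ r)
    (hω1 : ∑ a₁, ∑ b₁, ∑ r, ω a₁ b₁ r = 1) :
    Hup α (fun (a : A₁ × A₂) (b : B₁ × B₂) =>
        ∑ r, ω a.1 b.1 r * pB₂ b.2 * m a.2 r b.2) ≥
      Hup α (fun a₁ b₁ => ∑ r, ω a₁ b₁ r) +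
      sInf {x : ℝ | ∃ (E : Type) (_ : Fintype E) (ω' : R × E → ℝ),
        (∀ y, 0 ≤ ω' y) ∧ (∑ y, ω' y) = 1 ∧
        x = HpartialOut α pB₂
          (fun a₂ b₂ e => ∑ r, ω' (r, e) * pB₂ b₂ * m a₂ r b₂)} := by
  have hα0 : α ≠ 0 := by linarith
  have hcoef : α / (1 - α) < 0 := div_neg_of_pos_of_neg (by linarith) (by linarith)
  set S : Set ℝ := {x : ℝ | ∃ (E : Type) (_ : Fintype E) (ω' : R × E → ℝ),
        (∀ y, 0 ≤ ω' y) ∧ (∑ y, ω' y) = 1 ∧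
        x = HpartialOut α pB₂
          (fun a₂ b₂ e => ∑ r, ω' (r, e) * pB₂ b₂ * m a₂ r b₂)} with hS
  have hbdd : BddBelow S := by
    refine ⟨0, ?_⟩
    rintro x ⟨E, _, ω', h0, -, rfl⟩
    exact HpartialOut_nonneg hα pB₂ hpB0 hpB1 _ fun a b e =>
      sum_nonneg fun r _ => mul_nonneg (mul_nonneg (h0 _) (hpB0 b)) (hm0 a r b)
  have hw0 : ∀ a b, 0 ≤ ∑ r, ω a b r := fun a b => sum_nonneg fun r _ => hω0 a b r
  have hg0 : ∀ a₁ b₁ a₂ b₂, 0 ≤ ∑ r, ω a₁ b₁ r * m a₂ r b₂ := fun a₁ b₁ a₂ b₂ =>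
    sum_nonneg fun r _ => mul_nonneg (hω0 a₁ b₁ r) (hm0 a₂ r b₂)
  have hZ0 : ∀ b, 0 ≤ ∑ a, (∑ r, ω a b r) ^ α := fun b =>
    sum_nonneg fun a _ => rpow_nonneg (hw0 a b) α
  have hG0 : ∀ b₁ b₂, 0 ≤ ∑ a₁, ∑ a₂, (∑ r, ω a₁ b₁ r * m a₂ r b₂) ^ α := fun b₁ b₂ =>
    sum_nonneg fun a₁ _ => sum_nonneg fun a₂ _ => rpow_nonneg (hg0 a₁ b₁ a₂ b₂) α
  set c : ℝ := 2 ^ (sInf S / (α / (1 - α))) with hc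
  have hc0 : 0 < c := rpow_pos_of_pos two_pos _
  have hbound : ∀ b₁, ∑ b₂, pB₂ b₂ *
      (∑ a₁, ∑ a₂, (∑ r, ω a₁ b₁ r * m a₂ r b₂) ^ α) ^ (1 / α : ℝ) ≤
        (∑ a, (∑ r, ω a b₁ r) ^ α) ^ (1 / α : ℝ) * c := by
    intro b₁
    rcases (hZ0 b₁).eq_or_lt with h | h
    · have hw : ∀ a, ∑ r, ω a b₁ r = 0 := fun a =>
        ((rpow_eq_zero (hw0 a b₁) hα0).1 <| (sum_eq_zero_iff_of_nonneg
          fun a _ => rpow_nonneg (hw0 a b₁) α).1 h.symm a (mem_univ a))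
      have hz : ∀ a r, ω a b₁ r = 0 := fun a r =>
        (sum_eq_zero_iff_of_nonneg fun r _ => hω0 a b₁ r).1 (hw a) r (mem_univ r)
      simp [hz, hα0]
    · rw [mul_comm, ← div_le_iff₀ (rpow_pos_of_pos h _)]
      have hle : sInf S ≤ (α / (1 - α)) * logb 2 ((∑ b₂, pB₂ b₂ *
          (∑ a₁, ∑ a₂, (∑ r, ω a₁ b₁ r * m a₂ r b₂) ^ α) ^ (1 / α : ℝ)) /
            (∑ a, (∑ r, ω a b₁ r) ^ α) ^ (1 / α : ℝ)) := by
        rw [← HpartialOut_escort hα pB₂ m hm0 hm1 (fun a r => ω a b₁ r) (fun a r => hω0 a b₁ r) h]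
        refine csInf_le hbdd ⟨A₁, inferInstance, fun y => (∑ r', ω y.2 b₁ r') ^ (α - 1) *
          ω y.2 b₁ y.1 / ∑ e', (∑ r', ω e' b₁ r') ^ α, fun y => ?_, ?_, rfl⟩
        · exact div_nonneg (mul_nonneg (rpow_nonneg (hw0 _ _) _) (hω0 _ _ _)) (hZ0 b₁)
        · rw [← sum_div, div_eq_one_iff_eq h.ne', Fintype.sum_prod_type_right]
          refine sum_congr rfl fun a _ => ?_
          dsimp only
          rw [← mul_sum]
          rcases (hw0 a b₁).eq_or_lt with h' | h'
          · simp [← h', hα0]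
          · rw [rpow_sub_one h'.ne']
            field_simp
      have hT : 0 ≤ (∑ b₂, pB₂ b₂ *
          (∑ a₁, ∑ a₂, (∑ r, ω a₁ b₁ r * m a₂ r b₂) ^ α) ^ (1 / α : ℝ)) /
            (∑ a, (∑ r, ω a b₁ r) ^ α) ^ (1 / α : ℝ) :=
        div_nonneg (sum_nonneg fun b₂ _ => mul_nonneg (hpB0 b₂) (rpow_nonneg (hG0 b₁ b₂) _))
          (rpow_nonneg (hZ0 b₁) _)
      rcases hT.eq_or_lt with h' | h'
      · exact h' ▸ hc0.le
      · rw [hc, ← logb_le_iff_le_rpow one_lt_two h', le_div_iff_of_neg hcoef, mul_comm]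
        exact hle
  have hp0 : ∀ (a : A₁ × A₂) (b : B₁ × B₂), 0 ≤ ∑ r, ω a.1 b.1 r * pB₂ b.2 * m a.2 r b.2 :=
    fun a b => sum_nonneg fun r _ =>
      mul_nonneg (mul_nonneg (hω0 _ _ _) (hpB0 _)) (hm0 _ _ _)
  have hp1 : ∑ a : A₁ × A₂, ∑ b : B₁ × B₂, ∑ r, ω a.1 b.1 r * pB₂ b.2 * m a.2 r b.2 = 1 := by
    rw [sum_comm, Fintype.sum_prod_type]
    have key : ∀ b₁ b₂, ∑ a : A₁ × A₂, ∑ r, ω a.1 b₁ r * pB₂ b₂ * m a.2 r b₂ =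
        pB₂ b₂ * ∑ a₁, ∑ r, ω a₁ b₁ r := by
      intro b₁ b₂
      rw [Fintype.sum_prod_type, mul_sum]
      refine sum_congr rfl fun a₁ _ => ?_
      rw [sum_comm, mul_sum]
      refine sum_congr rfl fun r _ => ?_
      dsimp only
      rw [← mul_sum, hm1]
      ring
    simp only [key]
    simp only [← sum_mul, hpB1, one_mul]
    rw [sum_comm, hω1]
  rw [Hup_eq hα _ hp0, Hup_eq hα _ hw0]
  have hXpos := sum_rpow_pos (α := α) _ hp0 (hp1 ▸ one_pos)
  have hWpos := sum_rpow_pos (α := α) _ hw0 (hω1 ▸ one_pos)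
  have hX : ∑ b : B₁ × B₂, (∑ a : A₁ × A₂, (∑ r, ω a.1 b.1 r * pB₂ b.2 * m a.2 r b.2) ^ α) ^
      (1 / α : ℝ) ≤ (∑ b, (∑ a, (∑ r, ω a b r) ^ α) ^ (1 / α : ℝ)) * c := by
    rw [Fintype.sum_prod_type, sum_mul]
    refine sum_le_sum fun b₁ _ => (le_of_eq ?_).trans (hbound b₁)
    refine sum_congr rfl fun b₂ _ => ?_
    have hfac : ∀ (a₁ : A₁) (a₂ : A₂), (∑ r, ω a₁ b₁ r * pB₂ b₂ * m a₂ r b₂) ^ α =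
        pB₂ b₂ ^ α * (∑ r, ω a₁ b₁ r * m a₂ r b₂) ^ α := by
      intro a₁ a₂
      rw [← mul_rpow (hpB0 b₂) (hg0 a₁ b₁ a₂ b₂), mul_sum]
      congr 1
      exact sum_congr rfl fun r _ => by ring
    rw [Fintype.sum_prod_type]
    simp only [hfac, ← mul_sum]
    rw [mul_rpow (rpow_nonneg (hpB0 b₂) α) (hG0 b₁ b₂), one_div, rpow_rpow_inv (hpB0 b₂) hα0]
  have hlog := logb_le_logb_of_le one_lt_two hXpos hX
  rw [logb_mul hWpos.ne' hc0.ne', hc, logb_rpow two_pos (by norm_num)] at hlog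
  have := mul_le_mul_of_nonpos_left hlog hcoef.le
  rwa [mul_add, mul_div_cancel₀ _ hcoef.ne] at this
end

section
/- Let α ∈ (1,∞). For a,r,b ∈ {0,1} define k(a|r,b) := 1/2 if r⊕b = 0 and k(a|r,b) := [a=0] if r⊕b = 1 (⊕ denotes XOR, [·] the indicator). For a finite set E and a probability distribution q on {0,1}×E, define the output distribution p_q on {0,1}×{0,1}×E by p_q(a,b,e) := (1/2)·Σ_{r∈{0,1}} q(r,e)·k(a|r,b). Then the infimum over all finite sets E and all probability distributions q on {0,1}×E of H_α^↑(A|BE)_{p_q} equals (α/(1−α))·log( (1/2)·2^{(1−α)/α} + 1/2 ), and it is attained. -/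
/-- Pulling a positive normalization factor `m` out of an `ℓ^α` norm of a pair. -/
lemma mul_rpow_add_rpow_div {α m x y : ℝ} (hα : 0 < α) (hm : 0 < m) (hx : 0 ≤ x) (hy : 0 ≤ y) :
    m * ((x / m) ^ α + (y / m) ^ α) ^ (1 / α) = (x ^ α + y ^ α) ^ (1 / α) := by
  rw [Real.div_rpow hx hm.le, Real.div_rpow hy hm.le, ← add_div,
    Real.div_rpow (by positivity) (by positivity), ← Real.rpow_mul hm.le,
    mul_one_div_cancel hα.ne', Real.rpow_one]
  field_simp

/-- The `ℓ^α` norm of the mixture `x (1/4, 1/4) + y (1/2, 0)` is at most the mixture of norms. -/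
lemma rpow_add_rpow_mixture_le {α x y : ℝ} (hα : 1 < α) (hx : 0 ≤ x) (hy : 0 ≤ y) :
    ((x / 4) ^ α + (x / 4 + y / 2) ^ α) ^ (1 / α) ≤
      x / 2 * (2 : ℝ) ^ ((1 - α) / α) + y / 2 := by
  have h0 : 0 < α := by linarith
  have key := Real.Lp_add_le_of_nonneg (s := (Finset.univ : Finset Bool))
    (f := fun _ => x / 4) (g := fun a => cond a 0 (y / 2)) hα.le
    (fun _ _ => by positivity) (fun a _ => by cases a <;> dsimp only [cond] <;> positivity)
  simp only [Fintype.sum_bool, cond_true, cond_false, add_zero, Real.zero_rpow h0.ne', zero_add]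
    at key
  have h1 : ((x / 4) ^ α + (x / 4) ^ α) ^ (1 / α) = x / 2 * (2 : ℝ) ^ ((1 - α) / α) := by
    rw [← two_mul, Real.mul_rpow (by norm_num) (by positivity), ← Real.rpow_mul (by positivity),
      mul_one_div_cancel h0.ne', Real.rpow_one, sub_div, div_self h0.ne',
      Real.rpow_sub_one (by norm_num)]
    ring
  have h2 : ((y / 2) ^ α) ^ (1 / α) = y / 2 := by
    rw [← Real.rpow_mul (by positivity), mul_one_div_cancel h0.ne', Real.rpow_one]
  rwa [h1, h2] at key

/-- Bounds for the contribution of one value of the side information. -/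
lemma normalized_mixture_bounds {α x y : ℝ} (hα : 1 < α) (hx : 0 ≤ x) (hy : 0 ≤ y) :
    (x + y) / 4 ≤ (x + y) / 2 * ((x / 4 / ((x + y) / 2)) ^ α +
        ((x / 4 + y / 2) / ((x + y) / 2)) ^ α) ^ (1 / α) ∧
      (x + y) / 2 * ((x / 4 / ((x + y) / 2)) ^ α +
        ((x / 4 + y / 2) / ((x + y) / 2)) ^ α) ^ (1 / α) ≤
      x / 2 * (2 : ℝ) ^ ((1 - α) / α) + y / 2 := by
  have h0 : 0 < α := by linarith
  rcases (add_nonneg hx hy).eq_or_lt with h | h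
  · rw [← h]
    refine ⟨by simp, ?_⟩
    rw [zero_div, zero_mul]
    positivity
  · rw [mul_rpow_add_rpow_div h0 (by linarith) (by positivity) (by positivity)]
    refine ⟨?_, rpow_add_rpow_mixture_le hα hx hy⟩
    calc (x + y) / 4 ≤ x / 4 + y / 2 := by linarith
      _ = ((x / 4 + y / 2) ^ α) ^ (1 / α) := by
        rw [← Real.rpow_mul (by positivity), mul_one_div_cancel h0.ne', Real.rpow_one]
      _ ≤ _ := Real.rpow_le_rpow (by positivity)
        (le_add_of_nonneg_left (by positivity)) (by positivity)

/-- The entropy of the output distribution, with the sums over `A`, `B` and `R` expanded. -/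
lemma Hup_channel_eq (α : ℝ) (E : Type) [Fintype E] (q : Bool × E → ℝ) :
    Hup α (fun a (be : Bool × E) => (1 / 2) * ∑ r, q (r, be.2) * k a r be.1) =
      (α / (1 - α)) * Real.logb 2 (∑ e,
        ((q (true, e) + q (false, e)) / 2 *
            ((q (true, e) / 4 / ((q (true, e) + q (false, e)) / 2)) ^ α +
              ((q (true, e) / 4 + q (false, e) / 2) /
                ((q (true, e) + q (false, e)) / 2)) ^ α) ^ (1 / α) +
          (q (false, e) + q (true, e)) / 2 *
            ((q (false, e) / 4 / ((q (false, e) + q (true, e)) / 2)) ^ α +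
              ((q (false, e) / 4 + q (true, e) / 2) /
                ((q (false, e) + q (true, e)) / 2)) ^ α) ^ (1 / α))) := by
  unfold Hup
  congr 2
  rw [Fintype.sum_prod_type, Fintype.sum_bool, ← Finset.sum_add_distrib]
  refine Finset.sum_congr rfl fun e _ => ?_
  simp only [k, Fintype.sum_bool, Bool.true_eq_false, Bool.false_eq_true, if_true, if_false]
  ring_nf


/-- For the explicit channel `k` with uniformly sampled input `b`,
the infimum over all finite side-information sets `E` and all probability
distributions `q` on `{0,1} × E` of `H_α^↑(A|BE)` of the output distribution
`p_q(a,b,e) = (1/2)·Σ_r q(r,e)·k(a|r,b)` equals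
`(α/(1−α))·log((1/2)·2^{(1−α)/α} + 1/2)`, and it is attained. -/
theorem stmt16 (α : ℝ) (hα : 1 < α) :
    (∀ (E : Type) [Fintype E], ∀ q : Bool × E → ℝ, (∀ x, 0 ≤ q x) → (∑ x, q x) = 1 →
      (α / (1 - α)) * Real.logb 2
          ((1 / 2) * (2 : ℝ) ^ ((1 - α) / α : ℝ) + 1 / 2) ≤
        Hup α (fun a (be : Bool × E) => (1 / 2) * ∑ r, q (r, be.2) * k a r be.1)) ∧
    (∃ (E : Type) (_ : Fintype E) (q : Bool × E → ℝ), (∀ x, 0 ≤ q x) ∧ (∑ x, q x) = 1 ∧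
      Hup α (fun a (be : Bool × E) => (1 / 2) * ∑ r, q (r, be.2) * k a r be.1) =
        (α / (1 - α)) * Real.logb 2
          ((1 / 2) * (2 : ℝ) ^ ((1 - α) / α : ℝ) + 1 / 2)) := by
  have h0 : 0 < α := by linarith
  refine ⟨fun E _ q hq hsum => ?_, Unit, inferInstance, fun x => cond x.1 0 1, ?_, ?_, ?_⟩
  · rw [Hup_channel_eq]
    refine mul_le_mul_of_nonpos_left ?_ (div_nonpos_of_nonneg_of_nonpos h0.le (by linarith))
    rw [Fintype.sum_prod_type, Fintype.sum_bool, ← Finset.sum_add_distrib] at hsum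
    have hb := fun e => normalized_mixture_bounds hα (hq (true, e)) (hq (false, e))
    have hb' := fun e => normalized_mixture_bounds hα (hq (false, e)) (hq (true, e))
    apply Real.logb_le_logb_of_le (by norm_num)
    · have h := Finset.sum_le_sum fun e (_ : e ∈ Finset.univ) => add_le_add (hb e).1 (hb' e).1
      refine lt_of_lt_of_le ?_ h
      calc (0 : ℝ) < (∑ e, (q (true, e) + q (false, e))) * (1 / 2) := by rw [hsum]; norm_num
        _ = _ := by
          rw [Finset.sum_mul]
          exact Finset.sum_congr rfl fun e _ => by ring
    · refine (Finset.sum_le_sum fun e _ => add_le_add (hb e).2 (hb' e).2).trans_eq ?_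
      calc _ = (∑ e, (q (true, e) + q (false, e))) *
            ((1 / 2) * (2 : ℝ) ^ ((1 - α) / α) + 1 / 2) := by
            rw [Finset.sum_mul]
            exact Finset.sum_congr rfl fun e _ => by ring
        _ = _ := by rw [hsum, one_mul]
  · rintro ⟨_ | _, _⟩ <;> simp
  · simp [Fintype.sum_prod_type]
  · rw [Hup_channel_eq α Unit (fun x => cond x.1 0 1)]
    have h1 : (1 / 2 : ℝ) * ((1 / 2 : ℝ) ^ α + (1 / 2 : ℝ) ^ α) ^ (1 / α) =
        (1 / 2) * (2 : ℝ) ^ ((1 - α) / α) := by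
      rw [← two_mul, Real.mul_rpow (by norm_num) (by positivity),
        ← Real.rpow_mul (by positivity), mul_one_div_cancel h0.ne', Real.rpow_one, sub_div,
        div_self h0.ne', Real.rpow_sub_one (by norm_num)]
      ring
    rw [← h1]
    norm_num [Real.zero_rpow h0.ne']
    exact Or.inl (by ring_nf)
end
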